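/- Suppose γ ≥ ω₁ is an L-cardinal. Then the following are equivalent: (1) SRP^L(γ); (2) for every regular cardinal κ > γ, whenever X ≺ H_κ is countable with γ ∈ X, the image γ̄ of γ under the transitive collapse of X is an L-cardinal; (3) for some regular cardinal κ > γ, the set {X : X ≺ H_κ, |X| = ω, γ ∈ X, and γ̄ is an L-cardinal} contains a club of countable subsets of H_κ; (4) there exists a function F : γ^{<ω} → γ such that every countable X ⊆ γ closed under F has order type an L-cardinal; (5) for every regular cardinal κ > γ, the set {X : X ≺ H_κ, |X| = ω, γ ∈ X, and γ̄ is an L-cardinal} contains a club. -/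

import Mathlib

/-!
Common set-theoretic infrastructure for formalizing the paper
"The strong reflecting property and Harrington's Principle".

We work over Mathlib's `ZFSet.{0}` (a model of ZFC).  First-order satisfaction
for the language of set theory (with two auxiliary unary predicates) is
defined directly; Gödel's constructible hierarchy `L` (and its relativized
versions `L[A]`), hereditarily-small sets `H_κ`, transitive collapses,
clubs, elementary submodels, admissible ordinals, and the various
reflecting properties are all defined from first principles.
-/

noncomputable section
attribute [local instance] Classical.propDecidable
namespace SRPPaper

open ZFSet

/-- Image of a `ZFSet.{0}` under an arbitrary (classically definable) function. -/
def img (f : ZFSet.{0} → ZFSet.{0}) : ZFSet.{0} → ZFSet.{0} :=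
  @ZFSet.image f (Classical.allZFSetDefinable _)

/-! ### First-order formulas and satisfaction -/

/-- First-order formulas in the language `{∈, =, A, B}` where `A`, `B` are
unary predicate symbols; variables are de Bruijn-style indices in `Fin n`. -/
inductive Fml : ℕ → Type
  | mem {n} (i j : Fin n) : Fml n
  | eq {n} (i j : Fin n) : Fml n
  | inA {n} (i : Fin n) : Fml n
  | inB {n} (i : Fin n) : Fml n
  | not {n} : Fml n → Fml n
  | and {n} : Fml n → Fml n → Fml n
  | ex {n} : Fml (n + 1) → Fml n

/-- Satisfaction over the structure `(S, ∈, A, B)`; quantifiers range over `S`,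
the new variable of `ex` gets index `0`. -/
def SatAB (S A B : Set ZFSet.{0}) : ∀ {n}, Fml n → (Fin n → ZFSet.{0}) → Prop
  | _, .mem i j, v => v i ∈ v j
  | _, .eq i j, v => v i = v j
  | _, .inA i, v => v i ∈ A
  | _, .inB i, v => v i ∈ B
  | _, .not φ, v => ¬ SatAB S A B φ v
  | _, .and φ ψ, v => SatAB S A B φ v ∧ SatAB S A B ψ v
  | _, .ex φ, v => ∃ x ∈ S, SatAB S A B φ (Fin.cons x v)

/-- Pure `∈`-satisfaction over the structure `(S, ∈)`. -/
def Sat (S : Set ZFSet.{0}) {n} (φ : Fml n) (v : Fin n → ZFSet.{0}) : Prop :=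
  SatAB S ∅ ∅ φ v

/-- Δ₀ (bounded) formulas. -/
inductive IsDelta0 : ∀ {n}, Fml n → Prop
  | mem {n} (i j : Fin n) : IsDelta0 (.mem i j)
  | eq {n} (i j : Fin n) : IsDelta0 (.eq i j)
  | inA {n} (i : Fin n) : IsDelta0 (.inA i)
  | inB {n} (i : Fin n) : IsDelta0 (.inB i)
  | not {n} {φ : Fml n} : IsDelta0 φ → IsDelta0 (.not φ)
  | and {n} {φ ψ : Fml n} : IsDelta0 φ → IsDelta0 ψ → IsDelta0 (.and φ ψ)
  | bex {n} (j : Fin (n + 1)) {φ : Fml (n + 1)} : j ≠ 0 → IsDelta0 φ →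
      IsDelta0 (.ex (.and (.mem 0 j) φ))

/-- A Gödel code for formulas. -/
def codeF : ∀ {n}, Fml n → ℕ
  | _, .mem i j => Nat.pair 0 (Nat.pair i.val j.val)
  | _, .eq i j => Nat.pair 1 (Nat.pair i.val j.val)
  | _, .inA i => Nat.pair 2 i.val
  | _, .inB i => Nat.pair 3 i.val
  | _, .not φ => Nat.pair 4 (codeF φ)
  | _, .and φ ψ => Nat.pair 5 (Nat.pair (codeF φ) (codeF ψ))
  | _, .ex φ => Nat.pair 6 (codeF φ)

/-! ### Ordinals, von Neumann naturals -/

/-- `x` is a (von Neumann) ordinal: a transitive set of transitive sets. -/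
def IsOrd (x : ZFSet.{0}) : Prop :=
  x.IsTransitive ∧ ∀ y ∈ x, ZFSet.IsTransitive y

/-- `x` is a limit ordinal. -/
def IsLimitOrd (x : ZFSet.{0}) : Prop :=
  IsOrd x ∧ x ≠ ∅ ∧ ∀ y ∈ x, ∃ z ∈ x, y ∈ z

/-- The `n`-th von Neumann natural number. -/
def natZ : ℕ → ZFSet.{0}
  | 0 => ∅
  | n + 1 => insert (natZ n) (natZ n)

/-- Decoding of von Neumann naturals. -/
def zfToNat (x : ZFSet.{0}) : ℕ :=
  if h : ∃ n : ℕ, natZ n = x then h.choose else 0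

/-! ### Coded functions, products -/

/-- The cartesian product of two `ZFSet.{0}`s (as a set of Kuratowski pairs). -/
def prodZ (a b : ZFSet.{0}) : ZFSet.{0} :=
  ZFSet.sep (fun z => ∃ x, x ∈ a ∧ ∃ y, y ∈ b ∧ z = ZFSet.pair x y)
    (ZFSet.powerset (ZFSet.powerset (a ∪ b)))

/-- `f` codes a surjection from `a` onto `b`. -/
def IsSurjF (a b f : ZFSet.{0}) : Prop :=
  ZFSet.IsFunc a b f ∧ ∀ y, y ∈ b → ∃ x, x ∈ a ∧ ZFSet.pair x y ∈ f

/-- `f` codes an injection from `a` into `b`. -/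
def IsInjF (a b f : ZFSet.{0}) : Prop :=
  ZFSet.IsFunc a b f ∧
    ∀ x₁, x₁ ∈ a → ∀ x₂, x₂ ∈ a → ∀ y, ZFSet.pair x₁ y ∈ f → ZFSet.pair x₂ y ∈ f → x₁ = x₂

/-- The set of values of a coded function `f`. -/
def imageOf (f : ZFSet.{0}) : ZFSet.{0} :=
  ZFSet.sep (fun y => ∃ x, ZFSet.pair x y ∈ f) (ZFSet.sUnion (ZFSet.sUnion f))

/-! ### Cardinals (in `V`) -/

/-- `x` and `y` are equinumerous. -/
def EqNum (x y : ZFSet.{0}) : Prop := Nonempty (x.toSet ≃ y.toSet)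

/-- `|x| ≤ |y|`. -/
def CardLE (x y : ZFSet.{0}) : Prop := Nonempty (x.toSet ↪ y.toSet)

/-- `|x| < κ`, for `κ` a cardinal: `x` injects into some member of `κ`. -/
def CardLT (x κ : ZFSet.{0}) : Prop := ∃ α, α ∈ κ ∧ CardLE x α

/-- `κ` is a cardinal (of `V`). -/
def IsCard (κ : ZFSet.{0}) : Prop := IsOrd κ ∧ ∀ α ∈ κ, ¬ EqNum α κ

/-- `x` is unbounded (cofinal) in the ordinal `κ`. -/
def UnbIn (x κ : ZFSet.{0}) : Prop := ∀ β ∈ κ, ∃ γ ∈ x, β ∈ γ ∨ β = γ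

/-- `κ` is a regular cardinal: every cofinal subset of `κ` has size `κ`. -/
def IsRegular (κ : ZFSet.{0}) : Prop :=
  IsCard κ ∧ ∀ x : ZFSet.{0}, x ⊆ κ → UnbIn x κ → EqNum x κ

/-- The least ordinal satisfying `p` (junk value `∅` if there is none). -/
def leastOrd (p : ZFSet.{0} → Prop) : ZFSet.{0} :=
  if h : ∃ α, (IsOrd α ∧ p α) ∧ ∀ β ∈ α, ¬ (IsOrd β ∧ p β) then h.choose else ∅

/-- The cardinal `ℵₙ` of `V` (`Aleph 0 = ω`). -/
def Aleph : ℕ → ZFSet.{0}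
  | 0 => ZFSet.omega
  | n + 1 => leastOrd (fun κ => IsCard κ ∧ Aleph n ∈ κ)

/-- The cardinal successor (in `V`) of `κ`. -/
def SuccCard (κ : ZFSet.{0}) : ZFSet.{0} := leastOrd (fun α => IsCard α ∧ κ ∈ α)

/-- `X` is countable. -/
def Ctbl (X : ZFSet.{0}) : Prop := X.toSet.Countable

/-- `|X| = ω`: `X` is countably infinite. -/
def CtblInf (X : ZFSet.{0}) : Prop := X.toSet.Countable ∧ X.toSet.Infinite

/-! ### `H_κ`, elementary submodels, transitive collapse -/

/-- The class `H_κ` of sets hereditarily of cardinality `< κ`. -/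
def Hset (κ : ZFSet.{0}) : Set ZFSet.{0} :=
  {x | ∃ t : ZFSet.{0}, t.IsTransitive ∧ x ∈ t ∧ CardLT t κ}

/-- `X ≺ S`: `X` is an elementary submodel of the class `(S, ∈)`. -/
def ElemSub (X : ZFSet.{0}) (S : Set ZFSet.{0}) : Prop :=
  X.toSet ⊆ S ∧ ∀ {n : ℕ} (φ : Fml n) (v : Fin n → ZFSet.{0}),
    (∀ i, v i ∈ X) → (Sat X.toSet φ v ↔ Sat S φ v)

/-- The transitive-collapse map of (the ∈-structure on) `X`:
`collapse X y = {collapse X z | z ∈ y ∩ X}`.  For `γ ∈ X`, `collapse X γ` is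
the image `γ̄` of `γ` under the transitive collapse of `X`. -/
def collapse (X : ZFSet.{0}) : ZFSet.{0} → ZFSet.{0} :=
  ZFSet.mem_wf.fix (C := fun _ => ZFSet.{0}) fun y ih =>
    img (fun z => if h : z ∈ y then ih z h else ∅) (ZFSet.sep (fun z => z ∈ X) y)

/-- The transitive collapse of `X` (as a set). -/
def collapseSet (X : ZFSet.{0}) : ZFSet.{0} := img (fun y => collapse X y) X

/-- The transitive closure of (the members of) `x`. -/
def tcl : ZFSet.{0} → ZFSet.{0} :=
  ZFSet.mem_wf.fix (C := fun _ => ZFSet.{0}) fun x ih =>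
    x ∪ ZFSet.sUnion (img (fun y => if h : y ∈ x then ih y h else ∅) x)

/-- The (von Neumann) rank of a set, as an ordinal `ZFSet.{0}`. -/
def rankZ : ZFSet.{0} → ZFSet.{0} :=
  ZFSet.mem_wf.fix (C := fun _ => ZFSet.{0}) fun x ih =>
    ZFSet.sUnion (img (fun y => if h : y ∈ x then insert (ih y h) (ih y h) else ∅) x)

/-- The order type of a set `X` of ordinals: the unique ordinal `α` such that
`(X, ∈) ≅ (α, ∈)` (junk value `∅` if there is none). -/
def otype (X : ZFSet.{0}) : ZFSet.{0} :=
  if h : ∃ α, IsOrd α ∧ ∃ e : X.toSet ≃ α.toSet,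
      ∀ a b : X.toSet, (a : ZFSet.{0}) ∈ (b : ZFSet.{0}) ↔ ((e a : ZFSet.{0}) ∈ (e b : ZFSet.{0}))
  then h.choose else ∅

/-! ### The constructible hierarchy (relative to a predicate) -/

/-- The set of subsets of `X` definable over `(X, ∈, A)` with parameters. -/
def DefSetA (A : Set ZFSet.{0}) (X : ZFSet.{0}) : ZFSet.{0} :=
  ZFSet.sep (fun B => ∃ (n : ℕ) (φ : Fml (n + 1)) (v : Fin n → ZFSet.{0}),
      (∀ i, v i ∈ X) ∧ B = ZFSet.sep (fun z => SatAB X.toSet A ∅ φ (Fin.cons z v)) X)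
    (ZFSet.powerset X)

/-- The hierarchy `L_α[A]`: `LstageA A α = ⋃_{β ∈ α} Def_A (LstageA A β)`. -/
def LstageA (A : Set ZFSet.{0}) : ZFSet.{0} → ZFSet.{0} :=
  ZFSet.mem_wf.fix (C := fun _ => ZFSet.{0}) fun α ih =>
    ZFSet.sUnion (img (fun β => if h : β ∈ α then DefSetA A (ih β h) else ∅) α)

/-- Gödel's hierarchy `L_α`. -/
def Lstage : ZFSet.{0} → ZFSet.{0} := LstageA ∅

/-- The constructible universe `L`, as a class. -/
def LClass : Set ZFSet.{0} := {x | ∃ α, IsOrd α ∧ x ∈ Lstage α}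

/-- The class `L[A]`, for a set `A`. -/
def LrelClass (A : ZFSet.{0}) : Set ZFSet.{0} := {x | ∃ α, IsOrd α ∧ x ∈ LstageA A.toSet α}

/-- The constructible universe as computed inside a transitive (set or class)
model `W`: the union of the `L_α` for `α` an ordinal of `W`. -/
def LClassIn (W : Set ZFSet.{0}) : Set ZFSet.{0} :=
  {x | ∃ α, IsOrd α ∧ α ∈ W ∧ x ∈ Lstage α}

/-- `κ` is a cardinal in the (transitive) class `W`:
no coded surjection lying in `W` maps some `α < κ` onto `κ`. -/
def CardIn (W : Set ZFSet.{0}) (κ : ZFSet.{0}) : Prop :=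
  IsOrd κ ∧ ∀ α, α ∈ κ → ∀ f, f ∈ W → ¬ IsSurjF α κ f

/-- `κ` is an `L`-cardinal. -/
def LCard (κ : ZFSet.{0}) : Prop := CardIn LClass κ

/-! ### Clubs and stationarity on `[S]^ω` and on `κ` -/

/-- The union of an `ℕ`-indexed family of `ZFSet.{0}`s. -/
def seqUnion (f : ℕ → ZFSet.{0}) : ZFSet.{0} :=
  ZFSet.sUnion (img (fun m => f (zfToNat m)) ZFSet.omega)

/-- `C` is a club of countable subsets of `S`: every member is a countable
subset of `S`, `C` is `⊆`-cofinal in the countable subsets of `S`, and `C` is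
closed under unions of countable increasing chains. -/
def ClubSub (S : Set ZFSet.{0}) (C : Set ZFSet.{0}) : Prop :=
  (∀ X ∈ C, (X : ZFSet.{0}).toSet ⊆ S ∧ CtblInf X) ∧
  (∀ X : ZFSet.{0}, X.toSet ⊆ S → CtblInf X → ∃ Y ∈ C, X ⊆ Y) ∧
  (∀ f : ℕ → ZFSet.{0}, (∀ n, f n ∈ C) → (∀ n, f n ⊆ f (n + 1)) → seqUnion f ∈ C)

/-- `C` is stationary in `[S]^ω`: it meets every club of countable subsets. -/
def StatSub (S : Set ZFSet.{0}) (C : Set ZFSet.{0}) : Prop :=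
  ∀ D : Set ZFSet.{0}, ClubSub S D → ∃ X, X ∈ C ∧ X ∈ D

/-- `D` is a club (closed unbounded set) in the ordinal `κ`. -/
def ClubIn (κ D : ZFSet.{0}) : Prop :=
  D ⊆ κ ∧ (∀ β ∈ κ, ∃ θ, θ ∈ D ∧ β ∈ θ) ∧
  ∀ α, α ∈ κ → α ≠ ∅ → (∀ β ∈ α, ∃ θ, θ ∈ D ∧ θ ∈ α ∧ (β ∈ θ ∨ β = θ)) → α ∈ D

/-- `D` is stationary in the ordinal `κ`. -/
def StatIn (κ D : ZFSet.{0}) : Prop :=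
  D ⊆ κ ∧ ∀ C : ZFSet.{0}, ClubIn κ C → ∃ θ, θ ∈ D ∧ θ ∈ C

/-! ### The strong and weak reflecting properties -/

/-- `SRP^M(γ)` for an inner model given as a class `W`:  for some regular
cardinal `κ > γ`, whenever `X ≺ H_κ` is countable with `γ ∈ X`, the image of
`γ` under the transitive collapse of `X` is a cardinal of `W`. -/
def SRPclass (W : Set ZFSet.{0}) (γ : ZFSet.{0}) : Prop :=
  ∃ κ, IsRegular κ ∧ γ ∈ κ ∧
    ∀ X : ZFSet.{0}, ElemSub X (Hset κ) → CtblInf X → γ ∈ X → CardIn W (collapse X γ)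

/-- `SRP^L(γ)`: the strong reflecting property for `L`-cardinals. -/
def SRPL (γ : ZFSet.{0}) : Prop := SRPclass LClass γ

/-- `WRP^L(γ)`: the weak reflecting property for `L`-cardinals. -/
def WRPL (γ : ZFSet.{0}) : Prop :=
  ∃ κ, IsRegular κ ∧ γ ∈ κ ∧
    ∃ X : ZFSet.{0}, ElemSub X (Hset κ) ∧ CtblInf X ∧ γ ∈ X ∧ LCard (collapse X γ)

/-- `SRP^M_{<λ}(λ)`: for some regular `θ > λ`, every `X ≺ H_θ` with `|X| < λ`
and `λ ∈ X` collapses `λ` to a `W`-cardinal. -/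
def SRPlt (W : Set ZFSet.{0}) (lam : ZFSet.{0}) : Prop :=
  ∃ θ, IsRegular θ ∧ lam ∈ θ ∧
    ∀ X : ZFSet.{0}, ElemSub X (Hset θ) → CardLT X lam → lam ∈ X → CardIn W (collapse X lam)

/-! ### Notions relativized to a transitive (set or class) model `W` -/

/-- `κ` is a regular cardinal in `W`: `κ` is a `W`-cardinal and every coded
function in `W` from some `α < κ` into `κ` is bounded. -/
def RegularIn (W : Set ZFSet.{0}) (κ : ZFSet.{0}) : Prop :=
  CardIn W κ ∧ ∀ α, α ∈ κ → ∀ f, f ∈ W → ZFSet.IsFunc α κ f →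
    ∃ β, β ∈ κ ∧ ∀ ξ y, ξ ∈ α → ZFSet.pair ξ y ∈ f → y ∈ β

/-- `H_κ` as computed in `W`. -/
def HsetIn (W : Set ZFSet.{0}) (κ : ZFSet.{0}) : Set ZFSet.{0} :=
  {x | x ∈ W ∧ ∃ t, t ∈ W ∧ t.IsTransitive ∧ x ∈ t ∧
    ∃ f, f ∈ W ∧ ∃ α, α ∈ κ ∧ IsInjF t α f}

/-- `X` is countable in `W`. -/
def CtblIn (W : Set ZFSet.{0}) (X : ZFSet.{0}) : Prop :=
  X = ∅ ∨ ∃ f, f ∈ W ∧ IsSurjF ZFSet.omega X f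

/-- `|X| = ω` in `W`: countable and infinite in `W`. -/
def CtblInfIn (W : Set ZFSet.{0}) (X : ZFSet.{0}) : Prop :=
  CtblIn W X ∧ ∀ n, n ∈ ZFSet.omega → ∀ f, f ∈ W → ¬ IsSurjF n X f

/-- The `ω₁` of `W`. -/
def omega1In (W : Set ZFSet.{0}) : ZFSet.{0} :=
  leastOrd (fun α => CardIn W α ∧ ZFSet.omega ∈ α)

/-- The `ω₂` of `W`. -/
def omega2In (W : Set ZFSet.{0}) : ZFSet.{0} :=
  leastOrd (fun α => CardIn W α ∧ omega1In W ∈ α)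

/-- The cardinal successor of `κ` as computed in `W`. -/
def SuccCardIn (W : Set ZFSet.{0}) (κ : ZFSet.{0}) : ZFSet.{0} :=
  leastOrd (fun α => CardIn W α ∧ κ ∈ α)

/-- `WRP^L(γ)` as computed inside the (transitive) model `W`:  for some
`κ ∈ W` regular in `W` with `γ < κ` there is an `X ∈ W`, countably infinite
in `W`, with `X ≺ H_κ^W`, `γ ∈ X`, whose collapse sends `γ` to a cardinal of
the `L` of `W`. -/
def WRPLIn (W : Set ZFSet.{0}) (γ : ZFSet.{0}) : Prop :=
  ∃ κ, κ ∈ W ∧ RegularIn W κ ∧ γ ∈ κ ∧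
    ∃ X, X ∈ W ∧ ElemSub X (HsetIn W κ) ∧ CtblInfIn W X ∧ γ ∈ X ∧
      CardIn (LClassIn W) (collapse X γ)

/-- `SRP^L(γ)` as computed inside the (transitive) model `W`. -/
def SRPLIn (W : Set ZFSet.{0}) (γ : ZFSet.{0}) : Prop :=
  ∃ κ, κ ∈ W ∧ RegularIn W κ ∧ γ ∈ κ ∧
    ∀ X, X ∈ W → ElemSub X (HsetIn W κ) → CtblInfIn W X → γ ∈ X →
      CardIn (LClassIn W) (collapse X γ)

/-! ### Models of (fragments of) ZFC, semantically -/

/-- `W` is a transitive model of `ZFC⁻` (ZFC with Power Set deleted and with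
Collection), rendered semantically: nonempty, transitive, closed under
pairing and union, contains `ω`, satisfies full Separation and Collection for
first-order formulas with parameters, and Choice. -/
def ModelsZFCminus (W : Set ZFSet.{0}) : Prop :=
  (∃ x, x ∈ W) ∧
  (∀ x, x ∈ W → x.toSet ⊆ W) ∧
  (∀ x y, x ∈ W → y ∈ W → insert x (insert y (∅ : ZFSet.{0})) ∈ W) ∧
  (∀ x, x ∈ W → ZFSet.sUnion x ∈ W) ∧
  (ZFSet.omega ∈ W) ∧
  (∀ (n : ℕ) (φ : Fml (n + 1)) (v : Fin n → ZFSet.{0}), (∀ i, v i ∈ W) → ∀ a, a ∈ W →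
    ZFSet.sep (fun z => SatAB W ∅ ∅ φ (Fin.cons z v)) a ∈ W) ∧
  (∀ (n : ℕ) (φ : Fml (n + 2)) (v : Fin n → ZFSet.{0}), (∀ i, v i ∈ W) → ∀ a, a ∈ W →
    (∀ x, x ∈ a → ∃ y, y ∈ W ∧ SatAB W ∅ ∅ φ (Fin.cons x (Fin.cons y v))) →
    ∃ b, b ∈ W ∧ ∀ x, x ∈ a → ∃ y, y ∈ b ∧ SatAB W ∅ ∅ φ (Fin.cons x (Fin.cons y v))) ∧
  (∀ x, x ∈ W → (∀ y, y ∈ x → y ≠ ∅) →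
    ∃ c, c ∈ W ∧ ∀ y, y ∈ x → ∃! z, z ∈ y ∧ ZFSet.pair y z ∈ c)

/-- `W` is a transitive model of `ZFC` (with Power Set). -/
def ModelsZFC (W : Set ZFSet.{0}) : Prop :=
  ModelsZFCminus W ∧ ∀ x, x ∈ W → ∃ p, p ∈ W ∧ ∀ z, z ∈ W → (z ∈ p ↔ z ⊆ x)

/-- `W` is a model of `Z₂ = ZFC⁻ +` "every set is countable". -/
def ModelsZ2 (W : Set ZFSet.{0}) : Prop :=
  ModelsZFCminus W ∧ ∀ x, x ∈ W → CtblIn W x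

/-- `p` is the power set of `x` as computed in `W`. -/
def IsPowIn (W : Set ZFSet.{0}) (x p : ZFSet.{0}) : Prop :=
  p ∈ W ∧ ∀ z, z ∈ W → (z ∈ p ↔ z ⊆ x)

/-- `W` is a model of `Z₃ = ZFC⁻ + 𝒫(ω)` exists `+` every set has size `≤ ℶ₁`. -/
def ModelsZ3 (W : Set ZFSet.{0}) : Prop :=
  ModelsZFCminus W ∧ (∃ p, IsPowIn W ZFSet.omega p) ∧
    ∀ x, x ∈ W → ∀ p, IsPowIn W ZFSet.omega p → ∃ f, f ∈ W ∧ IsInjF x p f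

/-- `W` is a model of `Z₄ = ZFC⁻ + 𝒫(𝒫(ω))` exists `+` every set has size `≤ ℶ₂`. -/
def ModelsZ4 (W : Set ZFSet.{0}) : Prop :=
  ModelsZFCminus W ∧
    (∃ p q, IsPowIn W ZFSet.omega p ∧ IsPowIn W p q) ∧
    ∀ x, x ∈ W → ∀ p q, IsPowIn W ZFSet.omega p → IsPowIn W p q →
      ∃ f, f ∈ W ∧ IsInjF x q f

/-! ### Forcing: the Lévy collapse, genericity, generic extensions -/

/-- The Lévy collapse `Col(ω, <κ)`: finite partial functions `p` with
`p(α, n) ∈ α` for `α < κ`, `n < ω`. -/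
def ColLt (κ : ZFSet.{0}) : ZFSet.{0} :=
  ZFSet.sep (fun p => p.toSet.Finite ∧
      (∀ z, z ∈ p → ∃ α n β, α ∈ κ ∧ n ∈ ZFSet.omega ∧ β ∈ α ∧
        z = ZFSet.pair (ZFSet.pair α n) β) ∧
      (∀ α n β β', ZFSet.pair (ZFSet.pair α n) β ∈ p →
        ZFSet.pair (ZFSet.pair α n) β' ∈ p → β = β'))
    (ZFSet.powerset (prodZ (prodZ κ ZFSet.omega) (ZFSet.sUnion κ)))

/-- `G` is a filter on the partial order `P` of partial functions ordered by
reverse inclusion (`p` is stronger than `q` iff `q ⊆ p`) which meets every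
dense subset of `P` lying in the (transitive) model `W`. -/
def GenericOver (W : Set ZFSet.{0}) (P G : ZFSet.{0}) : Prop :=
  G ⊆ P ∧
  (∀ p q, p ∈ G → q ∈ P → q ⊆ p → q ∈ G) ∧
  (∀ p q, p ∈ G → q ∈ G → ∃ r, r ∈ G ∧ p ⊆ r ∧ q ⊆ r) ∧
  (∀ D, D ∈ W → D ⊆ P → (∀ p, p ∈ P → ∃ q, q ∈ D ∧ p ⊆ q) → ∃ q, q ∈ G ∧ q ∈ D)

/-- Genericity for an abstract partial order `R` (a set of pairs) on `P`:
`pair p q ∈ R` means `p` is stronger than (extends) `q`. -/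
def GenericOnP (W : Set ZFSet.{0}) (P R G : ZFSet.{0}) : Prop :=
  G ⊆ P ∧
  (∀ p q, p ∈ G → q ∈ P → ZFSet.pair p q ∈ R → q ∈ G) ∧
  (∀ p q, p ∈ G → q ∈ G → ∃ r, r ∈ G ∧ ZFSet.pair r p ∈ R ∧ ZFSet.pair r q ∈ R) ∧
  (∀ D, D ∈ W → D ⊆ P → (∀ p, p ∈ P → ∃ q, q ∈ D ∧ ZFSet.pair q p ∈ R) →
    ∃ q, q ∈ G ∧ q ∈ D)

/-- Evaluation of a forcing name `τ` by a filter `G`: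
`nameVal G τ = {nameVal G σ | ∃ p ∈ G, (σ, p) ∈ τ}`. -/
def nameVal (G : ZFSet.{0}) : ZFSet.{0} → ZFSet.{0} :=
  (ZFSet.mem_wf.transGen).fix (C := fun _ => ZFSet.{0}) fun τ ih =>
    img (fun σ => if h : Relation.TransGen (· ∈ ·) σ τ then ih σ h else ∅)
      (ZFSet.sep (fun σ => ∃ p, p ∈ G ∧ ZFSet.pair σ p ∈ τ)
        (ZFSet.sUnion (ZFSet.sUnion τ)))

/-- The generic extension `M[G]` of a transitive set model `M`, via names. -/
def extSet (M G : ZFSet.{0}) : Set ZFSet.{0} := {x | ∃ τ, τ ∈ M ∧ x = nameVal G τ}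

/-! ### Remarkable cardinals (Schindler), relative to a ground model class -/

/-- Clubs of countable subsets of `S`, as computed in the (transitive) model
`E`: the club is coded by a set `D ∈ E`, its members are subsets of `S`
countably infinite in `E`, it is cofinal among such sets lying in `E`, and it
is closed under unions of increasing `ω`-chains coded in `E`. -/
def ClubSubIn (E : Set ZFSet.{0}) (S : Set ZFSet.{0}) (D : ZFSet.{0}) : Prop :=
  D ∈ E ∧
  (∀ X, X ∈ D → X.toSet ⊆ S ∧ CtblInfIn E X) ∧
  (∀ X : ZFSet.{0}, X ∈ E → X.toSet ⊆ S → CtblInfIn E X → ∃ Y, Y ∈ D ∧ X ⊆ Y) ∧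
  (∀ g, g ∈ E → ZFSet.IsFunc ZFSet.omega D g →
    (∀ n y y', n ∈ ZFSet.omega → ZFSet.pair n y ∈ g →
      ZFSet.pair (insert n n) y' ∈ g → y ⊆ y') →
    ZFSet.sUnion (imageOf g) ∈ D)

/-- Stationarity of a collection `C` of countable subsets of `S`, as computed
in the model `E`. -/
def StatSubIn (E : Set ZFSet.{0}) (S : Set ZFSet.{0}) (C : Set ZFSet.{0}) : Prop :=
  ∀ D : ZFSet.{0}, ClubSubIn E S D → ∃ X, X ∈ C ∧ X ∈ D

/-- `X` condenses remarkably (with ground model `W`, extension operation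
`Ext` sending a generic object to the corresponding extension of `W`,
collapse height `δ`, target `θ`, and generic `G`):  `X = ran(π)` for some
elementary `π : (H_β^{W[G∩H_α^W]}, ∈, H_β^W, G∩H_α^W) → (H_θ^{W[G]}, ∈, H_θ^W, G)`
with `α = crit(π) < β < δ` and `β` a cardinal of `W`. -/
def CondensesRemarkably (W : Set ZFSet.{0}) (Ext : ZFSet.{0} → Set ZFSet.{0})
    (δ θ G X : ZFSet.{0}) : Prop :=
  ∃ (f : ZFSet.{0} → ZFSet.{0}) (α β : ZFSet.{0}), IsOrd α ∧ α ∈ β ∧ β ∈ δ ∧ CardIn W β ∧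
    (∀ ξ, ξ ∈ α → f ξ = ξ) ∧ f α ≠ α ∧
    (let Gα : ZFSet.{0} := ZFSet.sep (fun p => p ∈ HsetIn W α) G
     let Dom : Set ZFSet.{0} := HsetIn (Ext Gα) β
     let Cod : Set ZFSet.{0} := HsetIn (Ext G) θ
     Set.MapsTo f Dom Cod ∧ X.toSet = f '' Dom ∧
     ∀ (n : ℕ) (φ : Fml n) (v : Fin n → ZFSet.{0}), (∀ i, v i ∈ Dom) →
       (SatAB Dom W Gα.toSet φ v ↔ SatAB Cod W G.toSet φ (f ∘ v)))

/-- `δ` is `θ`-remarkable, in the sense of the (transitive) ground model `W`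
with extensions given by `Ext`: for every `G` which is `Col(ω, <δ)`-generic
over `W`, in `W[G]` the set of countable `X ⊆ H_θ^{W[G]}` which condense
remarkably is stationary. -/
def ThetaRemarkableVia (W : Set ZFSet.{0}) (Ext : ZFSet.{0} → Set ZFSet.{0})
    (δ θ : ZFSet.{0}) : Prop :=
  ∀ G, GenericOver W (ColLt δ) G →
    StatSubIn (Ext G) (HsetIn (Ext G) θ)
      {X | CondensesRemarkably W Ext δ θ G X}

/-- `δ` is remarkable in the sense of `(W, Ext)`:  `θ`-remarkable for every
regular (in `W`) `θ > δ`. -/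
def RemarkableVia (W : Set ZFSet.{0}) (Ext : ZFSet.{0} → Set ZFSet.{0}) (δ : ZFSet.{0}) : Prop :=
  ∀ θ, RegularIn W θ → δ ∈ θ → ThetaRemarkableVia W Ext δ θ

/-! ### Indiscernibles and sharps -/

/-- `I` is a set (or class) of ordinal indiscernibles for the structure
`(S, ∈, A)`. -/
def IndiscFor (S A : Set ZFSet.{0}) (I : Set ZFSet.{0}) : Prop :=
  (∀ x ∈ I, IsOrd x ∧ x ∈ S) ∧
  ∀ (n : ℕ) (φ : Fml n) (v w : Fin n → ZFSet.{0}),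
    (∀ i, v i ∈ I) → (∀ i, w i ∈ I) →
    (∀ i j : Fin n, i < j → v i ∈ v j) → (∀ i j : Fin n, i < j → w i ∈ w j) →
    (SatAB S A ∅ φ v ↔ SatAB S A ∅ φ w)

/-- `0♯` exists: for some uncountable limit ordinal `λ`, `L_λ` has an
uncountable set of indiscernibles. -/
def ZeroSharpExists : Prop :=
  ∃ lam : ZFSet.{0}, IsLimitOrd lam ∧ ¬ lam.toSet.Countable ∧
    ∃ I : ZFSet.{0}, ¬ I.toSet.Countable ∧ IndiscFor (Lstage lam).toSet ∅ I.toSet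

/-- The sharp of `L[A]` exists: for some uncountable limit ordinal `λ`, the
structure `(L_λ[A], ∈, A)` has an uncountable set of indiscernibles. -/
def SharpOverExists (A : ZFSet.{0}) : Prop :=
  ∃ lam : ZFSet.{0}, IsLimitOrd lam ∧ ¬ lam.toSet.Countable ∧
    ∃ I : ZFSet.{0}, ¬ I.toSet.Countable ∧
      IndiscFor (LstageA A.toSet lam).toSet A.toSet I.toSet

/-- `I` is a closed unbounded proper class of ordinals. -/
def ProperClassClub (I : Set ZFSet.{0}) : Prop :=
  (∀ x ∈ I, IsOrd x) ∧
  (∀ α, IsOrd α → ∃ β, IsOrd β ∧ α ∈ β ∧ β ∈ I) ∧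
  (∀ α, IsOrd α → α ≠ ∅ → (∀ β ∈ α, ∃ θ, θ ∈ I ∧ θ ∈ α ∧ (β ∈ θ ∨ β = θ)) → α ∈ I)

/-- `s` is (a real coding) `0♯`: there is a closed unbounded proper class `I`
of Silver indiscernibles for `L` and `s` is the set of codes of formulas
satisfied in `L` by increasing tuples from `I`. -/
def IsZeroSharpReal (s : ZFSet.{0}) : Prop :=
  s ⊆ ZFSet.omega ∧
  ∃ I : Set ZFSet.{0}, ProperClassClub I ∧ IndiscFor LClass ∅ I ∧
    s = ZFSet.sep (fun m => ∃ (n : ℕ) (φ : Fml n) (v : Fin n → ZFSet.{0}),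
          (∀ i, v i ∈ I) ∧ (∀ i j : Fin n, i < j → v i ∈ v j) ∧
          Sat LClass φ v ∧ m = natZ (Nat.pair n (codeF φ))) ZFSet.omega

/-! ### Admissible ordinals and Harrington's Principle -/

/-- The (graph of the) function `f` is `Σ₁`-definable with parameters over the
structure `(S, ∈)`. -/
def Sigma1DefOver (S : Set ZFSet.{0}) (f : ZFSet.{0} → ZFSet.{0}) : Prop :=
  ∃ (n : ℕ) (ψ : Fml (n + 3)), IsDelta0 ψ ∧
    ∃ p : Fin n → ZFSet.{0}, (∀ i, p i ∈ S) ∧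
      ∀ a b, a ∈ S → b ∈ S →
        (f a = b ↔ Sat S (Fml.ex ψ) (Fin.cons a (Fin.cons b p)))

/-- `α` is `x`-admissible: `α > ω` is a limit ordinal and no
`Σ₁(L_α[x])`-definable function maps some `δ < α` cofinally into `α`. -/
def Admissible (x α : ZFSet.{0}) : Prop :=
  IsLimitOrd α ∧ ZFSet.omega ∈ α ∧
  ¬ ∃ δ, δ ∈ α ∧ ∃ f : ZFSet.{0} → ZFSet.{0},
      Sigma1DefOver (LstageA x.toSet α).toSet f ∧
      (∀ β, β ∈ δ → f β ∈ α) ∧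
      ∀ ξ, ξ ∈ α → ∃ β, β ∈ δ ∧ (ξ ∈ f β ∨ ξ = f β)

/-- The generalized Harrington Principle `HP(M)` for the inner model given by
the class `W`: there is a real `x` such that every `x`-admissible ordinal is a
cardinal of `W`. -/
def HPclass (W : Set ZFSet.{0}) : Prop :=
  ∃ x : ZFSet.{0}, x ⊆ ZFSet.omega ∧ ∀ α, Admissible x α → CardIn W α

/-- Harrington's Principle `HP(L)`. -/
def HPL : Prop := HPclass LClass

/-- `HP(L)` as computed inside the (transitive) model `W`. -/
def HPLIn (W : Set ZFSet.{0}) : Prop :=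
  ∃ x, x ∈ W ∧ x ⊆ ZFSet.omega ∧
    ∀ α, α ∈ W → Admissible x α → CardIn (LClassIn W) α

/-! ### Inner models, elementary embeddings, rigidity, covering -/

/-- `W` is an inner model: a transitive proper class containing all ordinals
and satisfying ZFC. -/
def InnerModelClass (W : Set ZFSet.{0}) : Prop :=
  (∀ x, x ∈ W → x.toSet ⊆ W) ∧ (∀ α : ZFSet.{0}, IsOrd α → α ∈ W) ∧ ModelsZFC W

/-- `j` is an elementary embedding of the class `(W, ∈)` into itself. -/
def ElemEmbOn (W : Set ZFSet.{0}) (j : ZFSet.{0} → ZFSet.{0}) : Prop :=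
  Set.MapsTo j W W ∧
  ∀ (n : ℕ) (φ : Fml n) (v : Fin n → ZFSet.{0}),
    (∀ i, v i ∈ W) → (Sat W φ v ↔ Sat W φ (j ∘ v))

/-- `W` has the rigidity property: there is no nontrivial elementary embedding
from `W` to `W`. -/
def RigidClass (W : Set ZFSet.{0}) : Prop :=
  ¬ ∃ j : ZFSet.{0} → ZFSet.{0}, ElemEmbOn W j ∧ ∃ x, x ∈ W ∧ j x ≠ x

/-- `W` has the full covering property: every set `X` of ordinals is covered
by some `Y ∈ W` with `|Y| = |X| + ω₁`. -/
def FullCovering (W : Set ZFSet.{0}) : Prop :=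
  ∀ X : ZFSet.{0}, (∀ z ∈ X, IsOrd z) →
    ∃ Y, Y ∈ W ∧ X ⊆ Y ∧ Nonempty (Y.toSet ≃ (X.toSet ⊕ (Aleph 1).toSet))

/-- The restriction `M|θ` of the inner model `W`: its elements of rank `< θ`. -/
def restrictTo (W : Set ZFSet.{0}) (θ : ZFSet.{0}) : Set ZFSet.{0} :=
  {x | x ∈ W ∧ rankZ x ∈ θ}

/-- The class `S` is definable (with parameters) in `H_θ`. -/
def DefinableInH (θ : ZFSet.{0}) (S : Set ZFSet.{0}) : Prop :=
  ∃ (n : ℕ) (φ : Fml (n + 1)) (v : Fin n → ZFSet.{0}),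
    (∀ i, v i ∈ Hset θ) ∧ ∀ x, x ∈ Hset θ → (x ∈ S ↔ Sat (Hset θ) φ (Fin.cons x v))

/-- `ν` is weakly inaccessible in `W`: a regular limit cardinal of `W`. -/
def WeaklyInaccIn (W : Set ZFSet.{0}) (ν : ZFSet.{0}) : Prop :=
  RegularIn W ν ∧ ZFSet.omega ∈ ν ∧
    ∀ β, β ∈ ν → ∃ δ, δ ∈ ν ∧ β ∈ δ ∧ CardIn W δ

/-! ### Measures, `κ`-models and `0†` -/

/-- `⟨L[U], ∈, U⟩ ⊨ "U is a normal ultrafilter over κ"`:  `L[U]` is a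
`κ`-model. -/
def IsKappaModel (κ U : ZFSet.{0}) : Prop :=
  IsOrd κ ∧ ZFSet.omega ∈ κ ∧ U ∈ LrelClass U ∧
  (∀ X, X ∈ U → X ⊆ κ ∧ X ∈ LrelClass U) ∧ κ ∈ U ∧ (∅ : ZFSet.{0}) ∉ U ∧
  (∀ X Y, X ∈ U → Y ∈ U → X ∩ Y ∈ U) ∧
  (∀ X Y, X ∈ U → Y ∈ LrelClass U → X ⊆ Y → Y ⊆ κ → Y ∈ U) ∧
  (∀ X, X ∈ LrelClass U → X ⊆ κ → (X ∈ U ∨ κ \ X ∈ U)) ∧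
  (∀ α, α ∈ κ → (insert α ∅ : ZFSet.{0}) ∉ U) ∧
  (∀ δ g, δ ∈ κ → g ∈ LrelClass U → ZFSet.IsFunc δ (ZFSet.powerset κ) g →
    (∀ ξ y, ZFSet.pair ξ y ∈ g → y ∈ U) →
    ZFSet.sep (fun β => ∀ ξ, ξ ∈ δ → ∀ y, ZFSet.pair ξ y ∈ g → β ∈ y) κ ∈ U) ∧
  (∀ f X, f ∈ LrelClass U → X ∈ U → ZFSet.IsFunc κ κ f →
    (∀ α, α ∈ X → α ≠ ∅ → ∀ y, ZFSet.pair α y ∈ f → y ∈ α) →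
    ∃ β Y, β ∈ κ ∧ Y ∈ U ∧ ∀ α, α ∈ Y → ZFSet.pair α β ∈ f)

/-- `0†` exists: there is a `κ`-model (for some `κ`) and a nontrivial
elementary embedding from that model to itself with critical point
greater than `κ`. -/
def ZeroDaggerExists : Prop :=
  ∃ κ U : ZFSet.{0}, IsKappaModel κ U ∧
    ∃ j : ZFSet.{0} → ZFSet.{0}, ElemEmbOn (LrelClass U) j ∧
      ∃ η, IsOrd η ∧ κ ∈ η ∧ (∀ β, β ∈ η → j β = β) ∧ j η ≠ η

/-- `U` witnesses that `κ` is a measurable cardinal (in `V`): `U` is a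
`κ`-complete nonprincipal normal ultrafilter on `κ`. -/
def IsMeasureOn (κ U : ZFSet.{0}) : Prop :=
  IsOrd κ ∧ ZFSet.omega ∈ κ ∧
  (∀ X, X ∈ U → X ⊆ κ) ∧ κ ∈ U ∧ (∅ : ZFSet.{0}) ∉ U ∧
  (∀ X Y, X ∈ U → Y ∈ U → X ∩ Y ∈ U) ∧
  (∀ X Y, X ∈ U → X ⊆ Y → Y ⊆ κ → Y ∈ U) ∧
  (∀ X : ZFSet.{0}, X ⊆ κ → (X ∈ U ∨ κ \ X ∈ U)) ∧
  (∀ α, α ∈ κ → (insert α ∅ : ZFSet.{0}) ∉ U) ∧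
  (∀ x : ZFSet.{0}, x.toSet ⊆ U.toSet → CardLT x κ → x ≠ ∅ →
    ZFSet.sep (fun β => ∀ y, y ∈ x → β ∈ y) κ ∈ U) ∧
  (∀ f X, X ∈ U → ZFSet.IsFunc κ κ f →
    (∀ α, α ∈ X → α ≠ ∅ → ∀ y, ZFSet.pair α y ∈ f → y ∈ α) →
    ∃ β Y, β ∈ κ ∧ Y ∈ U ∧ ∀ α, α ∈ Y → ZFSet.pair α β ∈ f)

/-- `κ` is a measurable cardinal. -/
def IsMeasurable (κ : ZFSet.{0}) : Prop := ∃ U, IsMeasureOn κ U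

/-- `U ∈ W` witnesses measurability of `κ` inside the inner model `W`. -/
def MeasurableIn (W : Set ZFSet.{0}) (κ U : ZFSet.{0}) : Prop :=
  U ∈ W ∧ IsOrd κ ∧ ZFSet.omega ∈ κ ∧
  (∀ X, X ∈ U → X ⊆ κ) ∧ κ ∈ U ∧ (∅ : ZFSet.{0}) ∉ U ∧
  (∀ X Y, X ∈ U → Y ∈ U → X ∩ Y ∈ U) ∧
  (∀ X Y, X ∈ U → Y ∈ W → X ⊆ Y → Y ⊆ κ → Y ∈ U) ∧
  (∀ X, X ∈ W → X ⊆ κ → (X ∈ U ∨ κ \ X ∈ U)) ∧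
  (∀ α, α ∈ κ → (insert α ∅ : ZFSet.{0}) ∉ U) ∧
  (∀ δ g, δ ∈ κ → g ∈ W → ZFSet.IsFunc δ (ZFSet.powerset κ) g →
    (∀ ξ y, ZFSet.pair ξ y ∈ g → y ∈ U) →
    ZFSet.sep (fun β => ∀ ξ, ξ ∈ δ → ∀ y, ZFSet.pair ξ y ∈ g → β ∈ y) κ ∈ U)

/-- There is an inner model with a measurable cardinal. -/
def ExistsInnerModelMeasurable : Prop :=
  ∃ W : Set ZFSet.{0}, InnerModelClass W ∧ ∃ κ U, MeasurableIn W κ U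

/-! ### Core-model-like inner models -/

/-- `W` satisfies the GCH. -/
def GCHIn (W : Set ZFSet.{0}) : Prop :=
  ∀ κ, CardIn W κ → (ZFSet.omega ∈ κ ∨ ZFSet.omega = κ) →
    ∃ f, f ∈ W ∧ IsInjF (ZFSet.sep (fun z => z ∈ W) (ZFSet.powerset κ))
      (SuccCardIn W κ) f

/-- `W` has the condensation property: the transitive collapse of any
elementary submodel of an initial segment of `W` is again an initial segment
of `W`. -/
def CondensationFor (W : Set ZFSet.{0}) : Prop :=
  ∀ θ : ZFSet.{0}, IsOrd θ → ∀ X : ZFSet.{0},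
    X.toSet ⊆ restrictTo W θ → ElemSub X (restrictTo W θ) →
    ∃ θ', IsOrd θ' ∧ (collapseSet X).toSet = restrictTo W θ'

/-- The properties of the Dodd–Jensen core model `K` (below a measurable
cardinal) which are relevant here: `K` is an inner model satisfying the GCH,
with condensation, and (by Dodd–Jensen, given that there is no inner model
with a measurable) the rigidity property. -/
def CoreModelProps (W : Set ZFSet.{0}) : Prop :=
  InnerModelClass W ∧ GCHIn W ∧ CondensationFor W ∧ RigidClass W

/-! ### `L(ℝ)`, determinacy, and `HOD` -/

/-- The base of the `L(ℝ)` hierarchy: the transitive closure of `{𝒫(ω)}`. -/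
def lrBase : ZFSet.{0} :=
  insert (ZFSet.powerset ZFSet.omega) (tcl (ZFSet.powerset ZFSet.omega))

/-- The hierarchy `L_α(ℝ)`. -/
def LRstage : ZFSet.{0} → ZFSet.{0} :=
  ZFSet.mem_wf.fix (C := fun _ => ZFSet.{0}) fun α ih =>
    lrBase ∪ ZFSet.sUnion
      (img (fun β => if h : β ∈ α then DefSetA ∅ (ih β h) else ∅) α)

/-- The class `L(ℝ)`. -/
def LRClass : Set ZFSet.{0} := {x | ∃ α, IsOrd α ∧ x ∈ LRstage α}

/-- The `ZFSet` coding the function `ω → ω` given by `g`. -/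
def seqCode (g : ℕ → ℕ) : ZFSet.{0} :=
  img (fun m => ZFSet.pair m (natZ (g (zfToNat m)))) ZFSet.omega

/-- The game on `ω` with payoff `A` (a set of coded functions `ω → ω`) is
determined: one of the two players has a winning strategy. -/
def DeterminedZ (A : ZFSet.{0}) : Prop :=
  (∃ σ : List ℕ → ℕ, ∀ g : ℕ → ℕ,
    (∀ n : ℕ, g (2 * n) = σ (List.ofFn (fun i : Fin (2 * n) => g i.val))) →
    seqCode g ∈ A) ∨
  (∃ τ : List ℕ → ℕ, ∀ g : ℕ → ℕ,
    (∀ n : ℕ, g (2 * n + 1) = τ (List.ofFn (fun i : Fin (2 * n + 1) => g i.val))) →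
    seqCode g ∉ A)

/-- `AD^{L(ℝ)}`: every set of reals in `L(ℝ)` is determined.  (Since every
real, and every strategy, belongs to `L(ℝ)`, this is equivalent to `L(ℝ) ⊨ AD`.) -/
def ADinLR : Prop :=
  ∀ A, A ∈ LRClass → (∀ f, f ∈ A → ZFSet.IsFunc ZFSet.omega ZFSet.omega f) →
    DeterminedZ A

/-- `x` is ordinal definable. -/
def IsOD (x : ZFSet.{0}) : Prop :=
  ∃ (n : ℕ) (φ : Fml (n + 1)) (v : Fin n → ZFSet.{0}),
    (∀ i, IsOrd (v i)) ∧ ∀ y, (Sat Set.univ φ (Fin.cons y v) ↔ y = x)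

/-- The class `HOD` of hereditarily ordinal definable sets. -/
def HODClass : Set ZFSet.{0} :=
  {x | IsOD x ∧ ∀ y, y ∈ tcl x → IsOD y}

/-- The class `L[A]` as computed inside the (transitive) model `W`. -/
def LrelClassIn (W : Set ZFSet.{0}) (A : ZFSet.{0}) : Set ZFSet.{0} :=
  {x | ∃ α, IsOrd α ∧ α ∈ W ∧ x ∈ LstageA A.toSet α}

/-! ## Formulas and their meaning in transitive classes -/

/-- Transitive classes. -/
abbrev TClass := {S : Set ZFSet.{0} // ∀ x ∈ S, ∀ y ∈ x, y ∈ S}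

/-- Satisfaction in a transitive class, for assignments taking values in the class. -/
def SatM (M : TClass) {n} (φ : Fml n) (v : Fin n → M.1) : Prop :=
  Sat M.1 φ (fun i => (v i).1)

theorem cons_val {S : Set ZFSet.{0}} {n} (x : S) (v : Fin n → S) :
    (fun i => ((Fin.cons x v : Fin (n + 1) → S) i).1) =
      (Fin.cons x.1 (fun i => (v i).1) : Fin (n + 1) → ZFSet.{0}) := by
  funext i; refine Fin.cases ?_ (fun j => ?_) i <;> simp

namespace Fml

/-- Disjunction. -/
def or {n} (φ ψ : Fml n) : Fml n := .not (.and (.not φ) (.not ψ))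
/-- Implication. -/
def imp {n} (φ ψ : Fml n) : Fml n := .not (.and φ (.not ψ))
/-- Equivalence. -/
def iff {n} (φ ψ : Fml n) : Fml n := .and (imp φ ψ) (imp ψ φ)
/-- Universal quantification. -/
def all {n} (φ : Fml (n + 1)) : Fml n := .not (.ex (.not φ))
/-- Bounded existential quantification. -/
def bex {n} (j : Fin n) (φ : Fml (n + 1)) : Fml n := .ex (.and (.mem 0 j.succ) φ)
/-- Bounded universal quantification. -/
def ball {n} (j : Fin n) (φ : Fml (n + 1)) : Fml n := .not (bex j (.not φ))
/-- Disjunction of a finite family. -/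
def disj {n} {ι : Type} (f : ι → Fml (n + 1)) : List ι → Fml (n + 1)
  | [] => .not (.eq 0 0)
  | k :: l => or (f k) (disj f l)
/-- Conjunction of a finite family. -/
def conj {n} {ι : Type} (f : ι → Fml (n + 1)) : List ι → Fml (n + 1)
  | [] => .eq 0 0
  | k :: l => .and (f k) (conj f l)

end Fml

section Sat
variable {M : TClass} {n : ℕ} (v : Fin n → M.1)

theorem satM_mem (i j : Fin n) : SatM M (.mem i j) v ↔ (v i).1 ∈ (v j).1 := Iff.rfl

theorem satM_eq (i j : Fin n) : SatM M (.eq i j) v ↔ (v i).1 = (v j).1 := Iff.rfl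

theorem satM_not (φ : Fml n) : SatM M (.not φ) v ↔ ¬ SatM M φ v := Iff.rfl

theorem satM_and (φ ψ : Fml n) : SatM M (.and φ ψ) v ↔ SatM M φ v ∧ SatM M ψ v := Iff.rfl

theorem satM_ex (φ : Fml (n + 1)) :
    SatM M (.ex φ) v ↔ ∃ x : ZFSet.{0}, ∃ hx : x ∈ M.1, SatM M φ (Fin.cons ⟨x, hx⟩ v) := by
  constructor
  · rintro ⟨x, hx, h⟩
    refine ⟨x, hx, ?_⟩
    rw [SatM, cons_val]; exact h
  · rintro ⟨x, hx, h⟩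
    refine ⟨x, hx, ?_⟩
    rw [SatM, cons_val] at h; exact h

theorem satM_or (φ ψ : Fml n) : SatM M (φ.or ψ) v ↔ SatM M φ v ∨ SatM M ψ v := by
  rw [Fml.or, satM_not, satM_and, satM_not, satM_not]; tauto

theorem satM_imp (φ ψ : Fml n) : SatM M (φ.imp ψ) v ↔ (SatM M φ v → SatM M ψ v) := by
  rw [Fml.imp, satM_not, satM_and, satM_not]; tauto

theorem satM_iff (φ ψ : Fml n) : SatM M (φ.iff ψ) v ↔ (SatM M φ v ↔ SatM M ψ v) := by
  rw [Fml.iff, satM_and, satM_imp, satM_imp]; tauto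

theorem satM_all (φ : Fml (n + 1)) :
    SatM M (.all φ) v ↔ ∀ x : ZFSet.{0}, ∀ hx : x ∈ M.1, SatM M φ (Fin.cons ⟨x, hx⟩ v) := by
  simp only [Fml.all, satM_not, satM_ex]; push Not; rfl

theorem satM_bex (j : Fin n) (φ : Fml (n + 1)) :
    SatM M (.bex j φ) v ↔ ∃ x : ZFSet.{0}, ∃ hx : x ∈ (v j).1,
      SatM M φ (Fin.cons ⟨x, M.2 _ (v j).2 _ hx⟩ v) := by
  simp only [Fml.bex, satM_ex, satM_and, satM_mem, Fin.cons_zero, Fin.cons_succ]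
  exact ⟨fun ⟨x, _, h, h'⟩ => ⟨x, h, h'⟩, fun ⟨x, h, h'⟩ => ⟨x, M.2 _ (v j).2 _ h, h, h'⟩⟩

theorem satM_ball (j : Fin n) (φ : Fml (n + 1)) :
    SatM M (.ball j φ) v ↔ ∀ x : ZFSet.{0}, ∀ hx : x ∈ (v j).1,
      SatM M φ (Fin.cons ⟨x, M.2 _ (v j).2 _ hx⟩ v) := by
  simp only [Fml.ball, satM_not, satM_bex]; push Not; rfl

theorem satM_disj {ι : Type} (f : ι → Fml (n + 1)) (l : List ι) (v : Fin (n + 1) → M.1) :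
    SatM M (.disj f l) v ↔ ∃ k ∈ l, SatM M (f k) v := by
  induction l with
  | nil => simp [Fml.disj, satM_not, satM_eq]
  | cons k l ih => simp [Fml.disj, satM_or, ih]

theorem satM_conj {ι : Type} (f : ι → Fml (n + 1)) (l : List ι) (v : Fin (n + 1) → M.1) :
    SatM M (.conj f l) v ↔ ∀ k ∈ l, SatM M (f k) v := by
  induction l with
  | nil => simp [Fml.conj, satM_eq]
  | cons k l ih => simp [Fml.conj, satM_and, ih]

end Sat

/-! ### Pairs and finite sequences -/

namespace Fml
variable {n : ℕ}

/-- `x = ∅`. -/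
def isEmpty (x : Fin n) : Fml n := .not (bex x (.eq 0 0))
/-- `p = {a, b}`. -/
def isUPair (p a b : Fin n) : Fml n :=
  .and (.mem a p) (.and (.mem b p) (ball p (or (.eq 0 a.succ) (.eq 0 b.succ))))
/-- `p = (a, b)`. -/
def isPair (p a b : Fin n) : Fml n :=
  bex p (bex p.succ (.and (isUPair (Fin.succ 0) a.succ.succ a.succ.succ)
    (.and (isUPair 0 a.succ.succ b.succ.succ) (isUPair p.succ.succ (Fin.succ 0) 0))))
/-- `(a, b) ∈ R`. -/
def pairIn (a b R : Fin n) : Fml n := bex R (isPair 0 a.succ b.succ)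
/-- `x ⊆ y`. -/
def sub (x y : Fin n) : Fml n := ball x (.mem 0 y.succ)

end Fml

section Sat
variable {M : TClass} {n : ℕ} (v : Fin n → M.1)

theorem satM_isEmpty (x : Fin n) : SatM M (.isEmpty x) v ↔ (v x).1 = ∅ := by
  simp [Fml.isEmpty, satM_not, satM_bex, satM_eq, ZFSet.eq_empty]

theorem satM_isUPair (p a b : Fin n) :
    SatM M (.isUPair p a b) v ↔ (v p).1 = {(v a).1, (v b).1} := by
  simp only [Fml.isUPair, satM_and, satM_ball, satM_or, satM_eq, satM_mem, Fin.cons_zero,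
    Fin.cons_succ]
  rw [ZFSet.ext_iff]
  simp only [ZFSet.mem_pair]
  constructor
  · rintro ⟨ha, hb, h⟩ z
    exact ⟨h z, by rintro (rfl | rfl) <;> assumption⟩
  · intro h
    exact ⟨(h _).2 (.inl rfl), (h _).2 (.inr rfl), fun z hz => (h z).1 hz⟩

theorem satM_isPair (p a b : Fin n) :
    SatM M (.isPair p a b) v ↔ (v p).1 = pair (v a).1 (v b).1 := by
  simp only [Fml.isPair, satM_and, satM_bex, satM_isUPair, Fin.cons_zero, Fin.cons_succ]
  constructor
  · rintro ⟨s, _, t, _, hs, ht, h⟩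
    rw [h, hs, ht]; simp [pair]
  · intro h
    rw [h]
    exact ⟨{(v a).1}, by simp [pair], {(v a).1, (v b).1}, by simp [pair], by simp, rfl, rfl⟩

theorem satM_pairIn (a b R : Fin n) :
    SatM M (.pairIn a b R) v ↔ pair (v a).1 (v b).1 ∈ (v R).1 := by
  simp [Fml.pairIn, satM_bex, satM_isPair]

theorem satM_sub (x y : Fin n) : SatM M (.sub x y) v ↔ (v x).1 ⊆ (v y).1 := by
  simp only [Fml.sub, satM_ball, satM_mem, Fin.cons_zero, Fin.cons_succ]; rfl

end Sat

theorem cons_one {α : Type*} {n} (x : α) (v : Fin (n + 1) → α) :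
    (Fin.cons x v : Fin (n + 2) → α) 1 = v 0 := rfl

theorem cons_two {α : Type*} {n} (x : α) (v : Fin (n + 2) → α) :
    (Fin.cons x v : Fin (n + 3) → α) 2 = v 1 := by
  rw [← Fin.succ_one_eq_two, Fin.cons_succ]

theorem cons_three {α : Type*} {n} (x : α) (v : Fin (n + 3) → α) :
    (Fin.cons x v : Fin (n + 4) → α) 3 = v 2 := by
  have : (3 : Fin (n + 4)) = Fin.succ 2 := rfl
  rw [this, Fin.cons_succ]

theorem cons_four {α : Type*} {n} (x : α) (v : Fin (n + 4) → α) :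
    (Fin.cons x v : Fin (n + 5) → α) 4 = v 3 := by
  have : (4 : Fin (n + 5)) = Fin.succ 3 := rfl
  rw [this, Fin.cons_succ]

/-! ### Internal definability -/

/-- `W` is closed under the formation of finite sequences (coded as iterated pairs ending in `∅`)
from `X`, and consists of such. -/
def IsLW (X W : ZFSet.{0}) : Prop :=
  ∅ ∈ W ∧ (∀ x ∈ X, ∀ u ∈ W, pair x u ∈ W) ∧ ∀ w ∈ W, w = ∅ ∨ ∃ x ∈ X, ∃ u ∈ W, w = pair x u

/-- The operations generating all definable relations. -/
inductive Op
  | mem | eq | nand | ex | lift | swap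

/-- The list of all operations. -/
def Op.all : List Op := [.mem, .eq, .nand, .ex, .lift, .swap]

theorem Op.mem_all (k : Op) : k ∈ Op.all := by cases k <;> simp [Op.all]

/-- `w` belongs to the result of applying the operation to the relations `R` and `R'` on `X`. -/
def OpP (X W R R' w : ZFSet.{0}) : Op → Prop
  | .mem => ∃ x ∈ X, ∃ y ∈ X, ∃ u ∈ W, ∃ q ∈ W, q = pair y u ∧ w = pair x q ∧ x ∈ y
  | .eq => ∃ x ∈ X, ∃ y ∈ X, ∃ u ∈ W, ∃ q ∈ W, q = pair y u ∧ w = pair x q ∧ x = y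
  | .nand => ¬ (w ∈ R ∧ w ∈ R')
  | .ex => ∃ x ∈ X, pair x w ∈ R
  | .lift => ∃ x ∈ X, ∃ u ∈ R, w = pair x u
  | .swap => ∃ x ∈ X, ∃ y ∈ X, ∃ u ∈ W, ∃ q ∈ W, q = pair y u ∧ w = pair x q ∧
      ∃ r ∈ W, r = pair x u ∧ pair y r ∈ R

/-- `Q` is the result of applying the operation `k` to `R` and `R'` on `X`. -/
def IsOp (X W Q R R' : ZFSet.{0}) (k : Op) : Prop :=
  Q ⊆ W ∧ ∀ w ∈ W, w ∈ Q ↔ OpP X W R R' w k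

/-- `F` is the family of definable relations on `X`, where `D` assigns ranks from `C`. -/
def IsSF (X W F C D : ZFSet.{0}) : Prop :=
  (∃ Q ∈ F, Q = ∅) ∧
  (∀ R ∈ F, ∀ R' ∈ F, ∀ k ∈ Op.all, ∃ Q ∈ F, IsOp X W Q R R' k) ∧
  (∀ Q ∈ F, ∃ c ∈ C, pair c Q ∈ D) ∧
  ∀ c ∈ C, ∀ Q ∈ F, pair c Q ∈ D → Q = ∅ ∨ ∃ R ∈ F, ∃ R' ∈ F,
    (∃ d ∈ C, d ∈ c ∧ pair d R ∈ D) ∧ (∃ d ∈ C, d ∈ c ∧ pair d R' ∈ D) ∧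
    ∃ k ∈ Op.all, IsOp X W Q R R' k

/-- `y` is the section of the relation `Q` at the parameters `u`. -/
def IsSec (X Q u y : ZFSet.{0}) : Prop :=
  y ⊆ X ∧ ∀ z ∈ X, z ∈ y ↔ pair z u ∈ Q

/-- `K` consists of all sections of relations from `F`. -/
def IsSecs (X W F K : ZFSet.{0}) : Prop :=
  (∀ Q ∈ F, ∀ u ∈ W, ∃ y ∈ K, IsSec X Q u y) ∧ ∀ y ∈ K, ∃ Q ∈ F, ∃ u ∈ W, IsSec X Q u y

/-- `K` is the set of definable subsets of `X`, as witnessed in `M`. -/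
def DefIn (M : Set ZFSet.{0}) (X K : ZFSet.{0}) : Prop :=
  ∃ W, ∃ _ : W ∈ M, ∃ F, ∃ _ : F ∈ M, ∃ C, ∃ _ : C ∈ M, ∃ D, ∃ _ : D ∈ M,
    IsLW X W ∧ IsSF X W F C D ∧ IsSecs X W F K

/-- `s` is a set of stages of the constructible hierarchy, as witnessed in `M`. -/
def StgIn (M : Set ZFSet.{0}) (s : ZFSet.{0}) : Prop :=
  ∀ X ∈ s, (∀ Z ∈ s, Z ∈ X → ∃ K, ∃ _ : K ∈ M, DefIn M Z K ∧ K ⊆ X) ∧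
    ∀ y ∈ X, ∃ Z ∈ s, Z ∈ X ∧ ∃ K, ∃ _ : K ∈ M, DefIn M Z K ∧ y ∈ K

/-- `f` is constructible, as witnessed in `M`. -/
def InLIn (M : Set ZFSet.{0}) (f : ZFSet.{0}) : Prop :=
  ∃ s, ∃ _ : s ∈ M, (∃ X ∈ s, f ∈ X) ∧ StgIn M s

/-- `Y` is countable, as witnessed in `M`. -/
def CtblInM (M : Set ZFSet.{0}) (Y : ZFSet.{0}) : Prop :=
  ∃ O, ∃ _ : O ∈ M, ∃ W, ∃ _ : W ∈ M, ∃ g, ∃ _ : g ∈ M, (∀ a ∈ O, ∀ b ∈ O, a = b) ∧ IsLW O W ∧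
    (∀ y ∈ Y, ∃ n ∈ W, pair n y ∈ g) ∧
    ∀ n ∈ W, ∀ y ∈ Y, ∀ z ∈ Y, pair n y ∈ g → pair n z ∈ g → y = z

/-- `e` is an isomorphism from `(Y, ∈)` onto `(α, ∈)`. -/
def IsoD (Y α e : ZFSet.{0}) : Prop :=
  (∀ y ∈ Y, ∃ a ∈ α, pair y a ∈ e) ∧ (∀ a ∈ α, ∃ y ∈ Y, pair y a ∈ e) ∧
  ∀ y ∈ Y, ∀ a ∈ α, ∀ z ∈ Y, ∀ b ∈ α, pair y a ∈ e → pair z b ∈ e → (y ∈ z ↔ a ∈ b)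

/-- A bounded form of `IsSurjF`. -/
def SurjD (β α f : ZFSet.{0}) : Prop :=
  (∀ p ∈ f, ∃ a ∈ β, ∃ b ∈ α, p = pair a b) ∧
  (∀ z ∈ β, ∃ w ∈ α, pair z w ∈ f ∧ ∀ w' ∈ α, pair z w' ∈ f → w' = w) ∧
  ∀ y ∈ α, ∃ x ∈ β, pair x y ∈ f

/-- `α` is an ordinal, in bounded form. -/
def OrdD (α : ZFSet.{0}) : Prop :=
  (∀ x ∈ α, ∀ y ∈ x, y ∈ α) ∧ ∀ x ∈ α, ∀ y ∈ x, ∀ z ∈ y, z ∈ x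

/-- The order type of `Y` is not an `L`-cardinal, as witnessed in `M`. -/
def BadIn (M : Set ZFSet.{0}) (Y : ZFSet.{0}) : Prop :=
  ∃ α, ∃ _ : α ∈ M, ∃ e, ∃ _ : e ∈ M, ∃ f, ∃ _ : f ∈ M, OrdD α ∧ IsoD Y α e ∧
    (∃ β ∈ α, SurjD β α f) ∧ InLIn M f

/-- `F` codes a function such that the countable sets closed under it have order type an
`L`-cardinal, in the sense of `M`. -/
def ThetaIn (M : Set ZFSet.{0}) (γ F : ZFSet.{0}) : Prop :=
  (∃ W, ∃ _ : W ∈ M, IsLW γ W ∧ ∀ u ∈ W, ∃ a ∈ γ, pair u a ∈ F) ∧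
  ∀ Y, ∀ _ : Y ∈ M, Y ⊆ γ → ∀ W, ∀ _ : W ∈ M, IsLW Y W → CtblInM M Y →
    (∀ u ∈ W, ∃ a ∈ Y, pair u a ∈ F) → ¬ BadIn M Y

namespace Fml
variable {n : ℕ}

/-- The formula for `IsLW`. -/
def isLW (X W : Fin n) : Fml n :=
  .and (bex W (isEmpty 0)) (.and (ball X (ball W.succ (pairIn 1 0 W.succ.succ)))
    (ball W (or (isEmpty 0) (bex X.succ (bex W.succ.succ (isPair 2 1 0))))))

/-- The formula for `∃ x ∈ X, ∃ y ∈ X, ∃ u ∈ W, ∃ q ∈ W, q = (y, u) ∧ w = (x, q) ∧ φ`. -/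
def exShape (X W w : Fin n) (φ : Fml (n + 1 + 1 + 1 + 1)) : Fml n :=
  bex X (bex X.succ (bex W.succ.succ (bex W.succ.succ.succ
    (.and (isPair 0 2 1) (.and (isPair w.succ.succ.succ.succ 3 0) φ)))))

/-- The formula for `OpP`. -/
def opP (X W R R' w : Fin n) : Op → Fml n
  | .mem => exShape X W w (.mem 3 2)
  | .eq => exShape X W w (.eq 3 2)
  | .nand => .not (.and (.mem w R) (.mem w R'))
  | .ex => bex X (pairIn 0 w.succ R.succ)
  | .lift => bex X (bex R.succ (isPair w.succ.succ 1 0))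
  | .swap => exShape X W w (bex W.succ.succ.succ.succ
      (.and (isPair 0 4 2) (pairIn 3 0 R.succ.succ.succ.succ.succ)))

/-- The formula for `IsOp`. -/
def isOp (X W Q R R' : Fin n) (k : Op) : Fml n :=
  .and (sub Q W) (ball W (iff (.mem 0 Q.succ) (opP X.succ W.succ R.succ R'.succ 0 k)))

/-- The formula for `IsSF`. -/
def isSF (X W F C D : Fin n) : Fml n :=
  .and (bex F (isEmpty 0)) (.and
    (ball F (ball F.succ (conj (fun k => bex F.succ.succ
      (isOp X.succ.succ.succ W.succ.succ.succ 0 2 1 k)) Op.all))) (.and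
    (ball F (bex C.succ (pairIn 0 1 D.succ.succ)))
    (ball C (ball F.succ (imp (pairIn 1 0 D.succ.succ) (or (isEmpty 0)
      (bex F.succ.succ (bex F.succ.succ.succ (.and
        (bex C.succ.succ.succ.succ (.and (.mem 0 4) (pairIn 0 2 D.succ.succ.succ.succ.succ))) (.and
        (bex C.succ.succ.succ.succ (.and (.mem 0 4) (pairIn 0 1 D.succ.succ.succ.succ.succ)))
        (disj (isOp X.succ.succ.succ.succ W.succ.succ.succ.succ 2 1 0) Op.all)))))))))))

/-- The formula for `IsSec`. -/
def isSec (X Q u y : Fin n) : Fml n :=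
  .and (sub y X) (ball X (iff (.mem 0 y.succ) (pairIn 0 u.succ Q.succ)))

/-- The formula for `IsSecs`. -/
def isSecs (X W F K : Fin n) : Fml n :=
  .and (ball F (ball W.succ (bex K.succ.succ (isSec X.succ.succ.succ 2 1 0))))
    (ball K (bex F.succ (bex W.succ.succ (isSec X.succ.succ.succ 1 0 2))))

/-- The formula for `DefIn`. -/
def isDef (X K : Fin n) : Fml n :=
  .ex (.ex (.ex (.ex (.and (isLW X.succ.succ.succ.succ 3) (.and
    (isSF X.succ.succ.succ.succ 3 2 1 0)
    (isSecs X.succ.succ.succ.succ 3 2 K.succ.succ.succ.succ))))))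

/-- The formula for `StgIn`. -/
def isStg (s : Fin n) : Fml n :=
  ball s (.and
    (ball s.succ (imp (.mem 0 1) (.ex (.and (isDef 1 0) (sub 0 2)))))
    (ball 0 (bex s.succ.succ (.and (.mem 0 2) (.ex (.and (isDef 1 0) (.mem 2 0)))))))

/-- The formula for `InLIn`. -/
def inL (f : Fin n) : Fml n :=
  .ex (.and (bex 0 (.mem f.succ.succ 0)) (isStg 0))

/-- The formula for `CtblInM`. -/
def isCtbl (Y : Fin n) : Fml n :=
  .ex (.ex (.ex (.and (ball 2 (ball 3 (.eq 1 0))) (.and (isLW 2 1) (.and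
    (ball Y.succ.succ.succ (bex 2 (pairIn 0 1 2)))
    (ball 1 (ball Y.succ.succ.succ.succ (ball Y.succ.succ.succ.succ.succ
      (imp (pairIn 2 1 3) (imp (pairIn 2 0 3) (.eq 1 0)))))))))))

/-- The formula for `IsoD`. -/
def isIso (Y α e : Fin n) : Fml n :=
  .and (ball Y (bex α.succ (pairIn 1 0 e.succ.succ)))
    (.and (ball α (bex Y.succ (pairIn 0 1 e.succ.succ)))
      (ball Y (ball α.succ (ball Y.succ.succ (ball α.succ.succ.succ
        (imp (pairIn 3 2 e.succ.succ.succ.succ) (imp (pairIn 1 0 e.succ.succ.succ.succ)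
          (iff (.mem 3 1) (.mem 2 0)))))))))

/-- The formula for `SurjD`. -/
def isSurj (β α f : Fin n) : Fml n :=
  .and (ball f (bex β.succ (bex α.succ.succ (isPair 2 1 0))))
    (.and (ball β (bex α.succ (.and (pairIn 1 0 f.succ.succ)
      (ball α.succ.succ (imp (pairIn 2 0 f.succ.succ.succ) (.eq 0 1))))))
      (ball α (bex β.succ (pairIn 0 1 f.succ.succ))))

/-- The formula for `OrdD`. -/
def isOrd (α : Fin n) : Fml n :=
  .and (ball α (ball 0 (.mem 0 α.succ.succ))) (ball α (ball 0 (ball 0 (.mem 0 2))))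

/-- The formula for `BadIn`. -/
def isBad (Y : Fin n) : Fml n :=
  .ex (.ex (.ex (.and (isOrd 2) (.and (isIso Y.succ.succ.succ 2 1) (.and
    (bex 2 (isSurj 0 3 1)) (inL 0))))))

/-- The formula for `ThetaIn`. -/
def theta (γ F : Fin n) : Fml n :=
  .and (.ex (.and (isLW γ.succ 0) (ball 0 (bex γ.succ.succ (pairIn 1 0 F.succ.succ.succ)))))
    (all (imp (sub 0 γ.succ) (all (imp (isLW 1 0) (imp (isCtbl 1) (imp
      (ball 0 (bex 2 (pairIn 1 0 F.succ.succ.succ.succ))) (.not (isBad 1))))))))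

end Fml

attribute [simp] satM_mem satM_eq satM_not satM_and satM_ex satM_or satM_imp satM_iff
  satM_all satM_bex satM_ball satM_disj satM_conj satM_isEmpty satM_isUPair satM_isPair
  satM_pairIn satM_sub cons_one cons_two cons_three cons_four

section Sat
variable {M : TClass} {n : ℕ} (v : Fin n → M.1)

@[simp]
theorem satM_isLW (X W : Fin n) : SatM M (.isLW X W) v ↔ IsLW (v X).1 (v W).1 := by
  simp [Fml.isLW, IsLW]

@[simp]
theorem satM_opP (X W R R' w : Fin n) (k : Op) : SatM M (.opP X W R R' w k) v ↔
    OpP (v X).1 (v W).1 (v R).1 (v R').1 (v w).1 k := by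
  cases k <;> simp only [Fml.opP, OpP, Fml.exShape, satM_mem, satM_eq, satM_not, satM_and, satM_bex,
    satM_isPair, satM_pairIn, cons_one, cons_two, cons_three, cons_four, Fin.cons_zero,
    Fin.cons_succ, exists_prop]

@[simp]
theorem satM_isOp (X W Q R R' : Fin n) (k : Op) : SatM M (.isOp X W Q R R' k) v ↔
    IsOp (v X).1 (v W).1 (v Q).1 (v R).1 (v R').1 k := by
  simp [Fml.isOp, IsOp]

@[simp]
theorem satM_isSF (X W F C D : Fin n) : SatM M (.isSF X W F C D) v ↔
    IsSF (v X).1 (v W).1 (v F).1 (v C).1 (v D).1 := by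
  simp only [Fml.isSF, IsSF, satM_disj, satM_conj, satM_isOp, satM_mem, satM_and, satM_or,
    satM_imp, satM_bex, satM_ball, satM_isEmpty, satM_pairIn, cons_one, cons_two, cons_three,
    cons_four, Fin.cons_zero, Fin.cons_succ, exists_prop]

@[simp]
theorem satM_isSec (X Q u y : Fin n) : SatM M (.isSec X Q u y) v ↔
    IsSec (v X).1 (v Q).1 (v u).1 (v y).1 := by
  simp [Fml.isSec, IsSec]

@[simp]
theorem satM_isSecs (X W F K : Fin n) : SatM M (.isSecs X W F K) v ↔
    IsSecs (v X).1 (v W).1 (v F).1 (v K).1 := by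
  simp [Fml.isSecs, IsSecs]

@[simp]
theorem satM_isDef (X K : Fin n) : SatM M (.isDef X K) v ↔ DefIn M.1 (v X).1 (v K).1 := by
  simp [Fml.isDef, DefIn]

@[simp]
theorem satM_isStg (s : Fin n) : SatM M (.isStg s) v ↔ StgIn M.1 (v s).1 := by
  simp only [Fml.isStg, StgIn, satM_ex, satM_isDef, satM_mem, satM_and, satM_imp, satM_bex,
    satM_ball, satM_sub, cons_one, cons_two, Fin.cons_zero, Fin.cons_succ, exists_prop]

@[simp]
theorem satM_inL (f : Fin n) : SatM M (.inL f) v ↔ InLIn M.1 (v f).1 := by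
  simp [Fml.inL, InLIn]

@[simp]
theorem satM_isCtbl (Y : Fin n) : SatM M (.isCtbl Y) v ↔ CtblInM M.1 (v Y).1 := by
  simp [Fml.isCtbl, CtblInM]

@[simp]
theorem satM_isIso (Y α e : Fin n) : SatM M (.isIso Y α e) v ↔ IsoD (v Y).1 (v α).1 (v e).1 := by
  simp [Fml.isIso, IsoD]

@[simp]
theorem satM_isSurj (β α f : Fin n) :
    SatM M (.isSurj β α f) v ↔ SurjD (v β).1 (v α).1 (v f).1 := by
  simp only [Fml.isSurj, SurjD, satM_eq, satM_and, satM_imp, satM_bex, satM_ball, satM_isPair,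
    satM_pairIn, cons_one, cons_two, Fin.cons_zero, Fin.cons_succ, exists_prop]

@[simp]
theorem satM_isOrd (α : Fin n) : SatM M (.isOrd α) v ↔ OrdD (v α).1 := by
  simp [Fml.isOrd, OrdD]

@[simp]
theorem satM_isBad (Y : Fin n) : SatM M (.isBad Y) v ↔ BadIn M.1 (v Y).1 := by
  simp [Fml.isBad, BadIn]

theorem satM_theta (γ F : Fin n) : SatM M (.theta γ F) v ↔ ThetaIn M.1 (v γ).1 (v F).1 := by
  simp [Fml.theta, ThetaIn]

end Sat

/-! ### Codes for definable relations -/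

/-- The code of a finite sequence. -/
def enc : List ZFSet.{0} → ZFSet.{0}
  | [] => ∅
  | x :: l => pair x (enc l)

theorem pair_ne_empty (x y : ZFSet.{0}) : pair x y ≠ ∅ := by
  intro h
  have : ({x} : ZFSet.{0}) ∈ pair x y := by simp [pair]
  rw [h] at this
  exact ZFSet.notMem_empty _ this

theorem enc_injective : Function.Injective enc := by
  intro l
  induction l with
  | nil => rintro (_ | ⟨y, l'⟩) h
           · rfl
           · exact (pair_ne_empty _ _ h.symm).elim
  | cons x l ih =>
    rintro (_ | ⟨y, l'⟩) h
    · exact (pair_ne_empty _ _ h).elim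
    · obtain ⟨rfl, h'⟩ := pair_injective h
      rw [ih h']

theorem rank_lt_rank_pair (x y : ZFSet.{0}) : y.rank < (pair x y).rank :=
  (rank_lt_of_mem (show y ∈ ({x, y} : ZFSet.{0}) by simp)).trans
    (rank_lt_of_mem (show ({x, y} : ZFSet.{0}) ∈ pair x y by simp [pair]))

theorem IsLW.enc_mem {X W : ZFSet.{0}} (h : IsLW X W) {l : List ZFSet.{0}}
    (hl : ∀ x ∈ l, x ∈ X) : enc l ∈ W := by
  induction l with
  | nil => exact h.1
  | cons x l ih =>
    exact h.2.1 _ (hl _ (by simp)) _ (ih fun y hy => hl _ (by simp [hy]))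

theorem IsLW.exists_enc {X W : ZFSet.{0}} (h : IsLW X W) {w : ZFSet.{0}} (hw : w ∈ W) :
    ∃ l : List ZFSet.{0}, (∀ x ∈ l, x ∈ X) ∧ w = enc l := by
  induction hr : w.rank using WellFoundedLT.induction generalizing w with
  | ind o ih =>
    subst hr
    obtain rfl | ⟨x, hx, u, hu, rfl⟩ := h.2.2 w hw
    · exact ⟨[], by simp, rfl⟩
    · obtain ⟨l, hl, rfl⟩ := ih _ (rank_lt_rank_pair x u) hu rfl
      exact ⟨x :: l, by simpa [hx] using hl, rfl⟩

/-- The set of codes of finite sequences from `X`. -/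
def seqSet (X : ZFSet.{0}) : ZFSet.{0} :=
  ZFSet.range fun l : List X => enc (l.map Subtype.val)

theorem mem_seqSet {X w : ZFSet.{0}} :
    w ∈ seqSet X ↔ ∃ l : List ZFSet.{0}, (∀ x ∈ l, x ∈ X) ∧ w = enc l := by
  rw [seqSet, mem_range]
  constructor
  · rintro ⟨l, rfl⟩
    exact ⟨l.map Subtype.val, by simp +contextual, rfl⟩
  · rintro ⟨l, hl, rfl⟩
    refine ⟨l.attachWith _ hl, ?_⟩
    simp

theorem isLW_seqSet (X : ZFSet.{0}) : IsLW X (seqSet X) := by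
  refine ⟨mem_seqSet.2 ⟨[], by simp, rfl⟩, fun x hx u hu => ?_, fun w hw => ?_⟩
  · obtain ⟨l, hl, rfl⟩ := mem_seqSet.1 hu
    exact mem_seqSet.2 ⟨x :: l, by simpa [hx] using hl, rfl⟩
  · obtain ⟨_ | ⟨x, l⟩, hl, rfl⟩ := mem_seqSet.1 hw
    · exact .inl rfl
    · exact .inr ⟨x, hl _ (by simp), enc l,
        mem_seqSet.2 ⟨l, fun y hy => hl _ (by simp [hy]), rfl⟩, rfl⟩

/-- Codes for relations obtained from the empty relation by the operations `Op`. -/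
inductive RC
  | zero
  | op (k : Op) (a b : RC)

/-- The action of the operations on relations, given as predicates on lists. -/
def OpL (X : ZFSet.{0}) (k : Op) (A B : List ZFSet.{0} → Prop) : List ZFSet.{0} → Prop
  | l => match k, l with
    | .mem, x :: y :: _ => x ∈ y
    | .eq, x :: y :: _ => x = y
    | .nand, l => ¬ (A l ∧ B l)
    | .ex, l => ∃ x ∈ X, A (x :: l)
    | .lift, _ :: l => A l
    | .swap, x :: y :: l => A (y :: x :: l)
    | _, _ => False

/-- The relation on `X` coded by `r`. -/
def RC.holds (X : ZFSet.{0}) : RC → List ZFSet.{0} → Prop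
  | .zero => fun _ => False
  | .op k a b => OpL X k (a.holds X) (b.holds X)

/-- The set of codes of sequences from `X` satisfying the relation coded by `r`. -/
def RC.den (X W : ZFSet.{0}) (r : RC) : ZFSet.{0} :=
  ZFSet.sep (fun w => ∃ l : List ZFSet.{0}, (∀ x ∈ l, x ∈ X) ∧ w = enc l ∧ r.holds X l) W

theorem RC.enc_mem_den {X W : ZFSet.{0}} (hW : IsLW X W) (r : RC) {l : List ZFSet.{0}}
    (hl : ∀ x ∈ l, x ∈ X) : enc l ∈ r.den X W ↔ r.holds X l := by
  rw [RC.den, mem_sep]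
  constructor
  · rintro ⟨_, l', _, h, h'⟩
    rwa [enc_injective h]
  · exact fun h => ⟨hW.enc_mem hl, l, hl, rfl, h⟩

theorem RC.den_subset {X W : ZFSet.{0}} (r : RC) : r.den X W ⊆ W :=
  fun _ h => (mem_sep.1 h).1

theorem opP_enc {X W : ZFSet.{0}} (hW : IsLW X W) (a b : RC) (k : Op) {l : List ZFSet.{0}}
    (hl : ∀ x ∈ l, x ∈ X) :
    OpP X W (a.den X W) (b.den X W) (enc l) k ↔ OpL X k (a.holds X) (b.holds X) l := by
  have key : ∀ P : ZFSet.{0} → ZFSet.{0} → ZFSet.{0} → Prop,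
      (∃ x ∈ X, ∃ y ∈ X, ∃ u ∈ W, ∃ q ∈ W, q = pair y u ∧ enc l = pair x q ∧ P x y u) ↔
        ∃ x y l', l = x :: y :: l' ∧ P x y (enc l') := by
    intro P
    constructor
    · rintro ⟨x, hx, y, hy, u, hu, q, -, rfl, h, hP⟩
      obtain ⟨l', -, rfl⟩ := hW.exists_enc hu
      exact ⟨x, y, l', enc_injective h, hP⟩
    · rintro ⟨x, y, l', rfl, hP⟩
      have hl' : ∀ x ∈ y :: l', x ∈ X := fun z hz => hl _ (List.mem_cons_of_mem _ hz)
      exact ⟨x, hl _ (by simp), y, hl _ (by simp), _,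
        hW.enc_mem fun z hz => hl' _ (List.mem_cons_of_mem _ hz), _, hW.enc_mem hl', rfl, rfl, hP⟩
  cases k with
  | mem =>
    rw [OpP, key fun x y _ => x ∈ y]
    rcases l with _ | ⟨x, _ | ⟨y, l⟩⟩ <;> simp [OpL]
  | eq =>
    rw [OpP, key fun x y _ => x = y]
    rcases l with _ | ⟨x, _ | ⟨y, l⟩⟩ <;> simp [OpL, eq_comm]
  | nand => simp only [OpP, OpL, RC.enc_mem_den hW _ hl]
  | ex =>
    simp only [OpP, OpL]
    refine exists_congr fun x => and_congr_right fun hx => ?_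
    exact a.enc_mem_den hW (l := x :: l) (by simpa [hx] using hl)
  | lift =>
    simp only [OpP]
    constructor
    · rintro ⟨x, hx, u, hu, h⟩
      obtain ⟨l', hl', rfl⟩ := hW.exists_enc (RC.den_subset _ hu)
      obtain rfl : l = x :: l' := enc_injective h
      exact (a.enc_mem_den hW hl').1 hu
    · rcases l with _ | ⟨x, l⟩
      · exact False.elim
      · intro h
        exact ⟨x, hl _ (by simp), _, (a.enc_mem_den hW fun y hy => hl _ (by simp [hy])).2 h, rfl⟩
  | swap =>
    rw [OpP, key fun x y u => ∃ r ∈ W, r = pair x u ∧ pair y r ∈ a.den X W]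
    rcases l with _ | ⟨x, _ | ⟨y, l⟩⟩
    · simp [OpL]
    · simp [OpL]
    · have hl' : ∀ z ∈ x :: l, z ∈ X := fun z hz => hl _ (by simp at hz ⊢; tauto)
      have hl'' : ∀ z ∈ y :: x :: l, z ∈ X := fun z hz => hl _ (by simp at hz ⊢; tauto)
      rw [OpL, ← a.enc_mem_den hW hl'']
      constructor
      · rintro ⟨x', y', l', h, r, -, rfl, h'⟩
        obtain ⟨rfl, rfl, rfl⟩ : x = x' ∧ y = y' ∧ l = l' := by simpa using h
        exact h'
      · exact fun h => ⟨x, y, l, rfl, _, hW.enc_mem hl', rfl, h⟩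

theorem IsOp.unique {X W Q Q' R R' : ZFSet.{0}} {k : Op} (h : IsOp X W Q R R' k)
    (h' : IsOp X W Q' R R' k) : Q = Q' := by
  ext w
  constructor
  · exact fun hw => (h'.2 w (h.1 hw)).2 ((h.2 w (h.1 hw)).1 hw)
  · exact fun hw => (h.2 w (h'.1 hw)).2 ((h'.2 w (h'.1 hw)).1 hw)

theorem isOp_den {X W : ZFSet.{0}} (hW : IsLW X W) (k : Op) (a b : RC) :
    IsOp X W ((RC.op k a b).den X W) (a.den X W) (b.den X W) k := by
  refine ⟨RC.den_subset _, fun w hw => ?_⟩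
  obtain ⟨l, hl, rfl⟩ := hW.exists_enc hw
  rw [RC.enc_mem_den hW _ hl, opP_enc hW _ _ _ hl]
  rfl

theorem RC.den_zero (X W : ZFSet.{0}) : RC.zero.den X W = ∅ := by
  ext w; simp [RC.den, RC.holds]

theorem IsSF.mem_iff {X W F C D : ZFSet.{0}} (hW : IsLW X W) (h : IsSF X W F C D)
    {Q : ZFSet.{0}} : Q ∈ F ↔ ∃ r : RC, Q = r.den X W := by
  obtain ⟨⟨Q₀, h0, rfl⟩, hcl, hC, hD⟩ := h
  constructor
  · intro hQ
    obtain ⟨c, hc, hcQ⟩ := hC Q hQ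
    clear h0 hcl hC
    induction c using ZFSet.inductionOn generalizing Q with
    | h c ih =>
      obtain rfl | ⟨R, hR, R', hR', ⟨d, hd, hdc, hdR⟩, ⟨d', hd', hdc', hdR'⟩, k, -, hk⟩ :=
        hD c hc Q hQ hcQ
      · exact ⟨.zero, (RC.den_zero X W).symm⟩
      · obtain ⟨a, rfl⟩ := ih d hdc hR hd hdR
        obtain ⟨b, rfl⟩ := ih d' hdc' hR' hd' hdR'
        exact ⟨.op k a b, hk.unique (isOp_den hW k a b)⟩
  · rintro ⟨r, rfl⟩
    induction r with
    | zero => rwa [RC.den_zero]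
    | op k a b iha ihb =>
      obtain ⟨Q, hQ, hk⟩ := hcl _ iha _ ihb k k.mem_all
      rwa [← hk.unique (isOp_den hW k a b)]

/-- A set-theoretic rank for codes. -/
def RC.cod : RC → ZFSet.{0}
  | .zero => ∅
  | .op _ a b => {a.cod, b.cod}

instance : Small.{0} RC := small_self _

theorem isSF_range {X W : ZFSet.{0}} (hW : IsLW X W) :
    IsSF X W (ZFSet.range fun r : RC => r.den X W) (ZFSet.range RC.cod)
      (ZFSet.range fun r : RC => pair r.cod (r.den X W)) := by
  simp only [IsSF, mem_range]
  refine ⟨⟨∅, ⟨.zero, RC.den_zero X W⟩, rfl⟩, ?_, ?_, ?_⟩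
  · rintro _ ⟨a, rfl⟩ _ ⟨b, rfl⟩ k -
    exact ⟨_, ⟨.op k a b, rfl⟩, isOp_den hW k a b⟩
  · rintro _ ⟨a, rfl⟩
    exact ⟨_, ⟨a, rfl⟩, a, rfl⟩
  · rintro _ - _ - ⟨r, hr⟩
    obtain ⟨rfl, rfl⟩ := pair_injective hr
    rcases r with _ | ⟨k, a, b⟩
    · exact .inl (RC.den_zero X W)
    · exact .inr ⟨_, ⟨a, rfl⟩, _, ⟨b, rfl⟩, ⟨_, ⟨a, rfl⟩, by simp [RC.cod], a, rfl⟩,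
        ⟨_, ⟨b, rfl⟩, by simp [RC.cod], b, rfl⟩, k, k.mem_all, isOp_den hW k a b⟩

namespace RC

/-- Complement. -/
def neg (a : RC) : RC := .op .nand a a
/-- Intersection. -/
def inter (a b : RC) : RC := neg (.op .nand a b)
/-- The relation `l[k + 1] = l[0]`. -/
def eqAt : ℕ → RC
  | 0 => .op .eq .zero .zero
  | k + 1 => .op .swap (.op .lift (eqAt k) .zero) .zero
/-- The relation obtained by evaluating a binary relation at the entries `i` and `j`. -/
def atPos (i j : ℕ) (r : RC) : RC :=
  .op .ex (.op .ex (inter (inter (.op .swap (.op .lift (eqAt j) .zero) .zero)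
    (.op .lift (eqAt i) .zero)) r) .zero) .zero

variable (X : ZFSet.{0})

theorem holds_neg (a : RC) (l : List ZFSet.{0}) : (neg a).holds X l ↔ ¬ a.holds X l := by
  simp [neg, holds, OpL]

theorem holds_inter (a b : RC) (l : List ZFSet.{0}) :
    (inter a b).holds X l ↔ a.holds X l ∧ b.holds X l := by
  simp [inter, holds_neg, holds, OpL]

theorem holds_eqAt (k : ℕ) (x : ZFSet.{0}) (l : List ZFSet.{0}) :
    (eqAt k).holds X (x :: l) ↔ l[k]? = some x := by
  induction k generalizing l with
  | zero => cases l <;> simp [eqAt, holds, OpL, eq_comm]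
  | succ k ih => cases l <;> simp [eqAt, holds, OpL, ih]

theorem holds_atPos {i j : ℕ} {r : RC} {l : List ZFSet.{0}} {a b : ZFSet.{0}} (ha : l[i]? = some a)
    (hb : l[j]? = some b) (haX : a ∈ X) (hbX : b ∈ X) :
    (atPos i j r).holds X l ↔ r.holds X (b :: a :: l) := by
  simp only [atPos, holds, OpL, holds_inter, holds_eqAt, ha, hb, Option.some.injEq]
  constructor
  · rintro ⟨_, _, _, _, ⟨rfl, rfl⟩, h⟩
    exact h
  · exact fun h => ⟨a, haX, b, hbX, ⟨rfl, rfl⟩, h⟩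

end RC

theorem exists_holds_iff_sat (X : ZFSet.{0}) {n : ℕ} (φ : Fml n) : ∃ r : RC,
    ∀ v : Fin n → ZFSet.{0}, (∀ i, v i ∈ X) →
      (SatAB X.toSet ∅ ∅ φ v ↔ r.holds X (List.ofFn v)) := by
  have get : ∀ {n : ℕ} (v : Fin n → ZFSet.{0}) (i : Fin n),
      (List.ofFn v)[i.1]? = some (v i) := fun v i => by simp
  induction φ with
  | mem i j =>
    refine ⟨.atPos j i (.op .mem .zero .zero), fun v hv => ?_⟩
    rw [RC.holds_atPos X (get v j) (get v i) (hv j) (hv i)]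
    rfl
  | eq i j =>
    refine ⟨.atPos j i (.op .eq .zero .zero), fun v hv => ?_⟩
    rw [RC.holds_atPos X (get v j) (get v i) (hv j) (hv i)]
    rfl
  | inA i => exact ⟨.zero, fun v _ => Iff.rfl⟩
  | inB i => exact ⟨.zero, fun v _ => Iff.rfl⟩
  | not φ ih =>
    obtain ⟨r, hr⟩ := ih
    exact ⟨r.neg, fun v hv => by rw [RC.holds_neg, ← hr v hv]; rfl⟩
  | and φ ψ ih ih' =>
    obtain ⟨r, hr⟩ := ih
    obtain ⟨r', hr'⟩ := ih'
    exact ⟨r.inter r', fun v hv => by rw [RC.holds_inter, ← hr v hv, ← hr' v hv]; rfl⟩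
  | ex φ ih =>
    obtain ⟨r, hr⟩ := ih
    refine ⟨.op .ex r .zero, fun v hv => ?_⟩
    refine exists_congr fun x => and_congr_right fun hx => ?_
    rw [hr _ (Fin.cases hx hv), List.ofFn_cons]

theorem exists_sat_iff_holds (X : ZFSet.{0}) (r : RC) : ∀ {n m : ℕ} (ρ : Fin n → Fin m),
    ∃ φ : Fml m, ∀ v : Fin m → ZFSet.{0}, (∀ i, v i ∈ X) →
      (r.holds X (List.ofFn fun i => v (ρ i)) ↔ SatAB X.toSet ∅ ∅ φ v) := by
  have no : ∀ m, ∃ φ : Fml m, ∀ v, ¬ SatAB X.toSet ∅ ∅ φ v := fun m =>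
    ⟨.ex (.not (.eq 0 0)), fun v ⟨x, _, h⟩ => h rfl⟩
  have no' : ∀ {P : ZFSet.{0} → Prop} {m} (Q : (Fin m → ZFSet.{0}) → Prop), (∀ v, ¬ Q v) →
      ∃ φ : Fml m, ∀ v, (∀ i, P (v i)) → (Q v ↔ SatAB X.toSet ∅ ∅ φ v) := fun Q hQ => by
    obtain ⟨φ, hφ⟩ := no _
    exact ⟨φ, fun v _ => iff_of_false (hQ v) (hφ v)⟩
  induction r with
  | zero => exact fun ρ => no' _ fun v => id
  | op k a b iha ihb =>
    intro n m ρ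
    cases k with
    | mem =>
      rcases n with _ | _ | n
      · exact no' _ fun v => by simp [RC.holds, OpL]
      · exact no' _ fun v => by simp [RC.holds, OpL]
      · exact ⟨.mem (ρ 0) (ρ 1), fun v _ => by simp [RC.holds, OpL, SatAB, List.ofFn_succ]⟩
    | eq =>
      rcases n with _ | _ | n
      · exact no' _ fun v => by simp [RC.holds, OpL]
      · exact no' _ fun v => by simp [RC.holds, OpL]
      · exact ⟨.eq (ρ 0) (ρ 1), fun v _ => by simp [RC.holds, OpL, SatAB, List.ofFn_succ]⟩
    | nand =>
      obtain ⟨φ, hφ⟩ := iha ρ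
      obtain ⟨ψ, hψ⟩ := ihb ρ
      exact ⟨.not (.and φ ψ), fun v hv => by
        simp only [RC.holds, OpL, SatAB, hφ v hv, hψ v hv]⟩
    | ex =>
      obtain ⟨φ, hφ⟩ := iha (Fin.cons 0 fun i => (ρ i).succ : Fin (n + 1) → Fin (m + 1))
      refine ⟨.ex φ, fun v hv => exists_congr fun x => and_congr_right fun hx => ?_⟩
      rw [← hφ _ (Fin.cases hx hv), List.ofFn_succ]
      simp
    | lift =>
      rcases n with _ | n
      · exact no' _ fun v => by simp [RC.holds, OpL]
      · obtain ⟨φ, hφ⟩ := iha fun i => ρ i.succ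
        exact ⟨φ, fun v hv => by rw [← hφ v hv, List.ofFn_succ]; rfl⟩
    | swap =>
      rcases n with _ | _ | n
      · exact no' _ fun v => by simp [RC.holds, OpL]
      · exact no' _ fun v => by simp [RC.holds, OpL]
      · obtain ⟨φ, hφ⟩ := iha (Fin.cons (ρ 1) (Fin.cons (ρ 0) fun i => ρ i.succ.succ) :
          Fin (n + 2) → Fin m)
        exact ⟨φ, fun v hv => by
          rw [← hφ v hv]; simp [List.ofFn_succ, RC.holds, OpL]⟩

/-- Definable subsets are exactly the sections of coded relations. -/
theorem mem_defSetA {X B : ZFSet.{0}} : B ∈ DefSetA ∅ X ↔ ∃ (r : RC) (l : List ZFSet.{0}),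
    (∀ x ∈ l, x ∈ X) ∧ B = ZFSet.sep (fun z => r.holds X (z :: l)) X := by
  rw [DefSetA, mem_sep, mem_powerset]
  constructor
  · rintro ⟨-, n, φ, v, hv, rfl⟩
    obtain ⟨r, hr⟩ := exists_holds_iff_sat X φ
    refine ⟨r, List.ofFn v, by simpa [List.mem_ofFn] using hv, ?_⟩
    ext z
    rw [mem_sep, mem_sep]
    refine and_congr_right fun hz => ?_
    rw [hr _ (Fin.cases hz hv), List.ofFn_cons]
  · rintro ⟨r, l, hl, rfl⟩
    refine ⟨fun z hz => (mem_sep.1 hz).1, ?_⟩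
    obtain ⟨φ, hφ⟩ := exists_sat_iff_holds X r (id : Fin (l.length + 1) → _)
    have hv : ∀ i, l.get i ∈ X := fun i => hl _ (l.get_mem i)
    refine ⟨_, φ, l.get, hv, ?_⟩
    ext z
    rw [mem_sep, mem_sep]
    refine and_congr_right fun hz => ?_
    rw [← hφ _ (Fin.cases hz hv)]
    simp only [id, List.ofFn_cons, List.ofFn_get]

theorem isSec_den {X W : ZFSet.{0}} (hW : IsLW X W) (r : RC) {l : List ZFSet.{0}}
    (hl : ∀ x ∈ l, x ∈ X) {y : ZFSet.{0}} :
    IsSec X (r.den X W) (enc l) y ↔ y = ZFSet.sep (fun z => r.holds X (z :: l)) X := by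
  have key : ∀ z ∈ X, pair z (enc l) ∈ r.den X W ↔ r.holds X (z :: l) := fun z hz =>
    r.enc_mem_den hW (l := z :: l) (by simpa [hz] using hl)
  constructor
  · rintro ⟨hy, h⟩
    ext z
    rw [mem_sep]
    exact ⟨fun hz => ⟨hy hz, (key z (hy hz)).1 ((h z (hy hz)).1 hz)⟩,
      fun hz => (h z hz.1).2 ((key z hz.1).2 hz.2)⟩
  · rintro rfl
    exact ⟨fun z hz => (mem_sep.1 hz).1, fun z hz => by rw [mem_sep, key z hz]; simp [hz]⟩

theorem isSecs_iff {X W F C D K : ZFSet.{0}} (hW : IsLW X W) (h : IsSF X W F C D) :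
    IsSecs X W F K ↔ K = DefSetA ∅ X := by
  constructor
  · rintro ⟨h1, h2⟩
    ext y
    rw [mem_defSetA]
    constructor
    · intro hy
      obtain ⟨Q, hQ, u, hu, hs⟩ := h2 y hy
      obtain ⟨r, rfl⟩ := (h.mem_iff hW).1 hQ
      obtain ⟨l, hl, rfl⟩ := hW.exists_enc hu
      exact ⟨r, l, hl, (isSec_den hW r hl).1 hs⟩
    · rintro ⟨r, l, hl, rfl⟩
      obtain ⟨y, hy, hs⟩ := h1 _ ((h.mem_iff hW).2 ⟨r, rfl⟩) _ (hW.enc_mem hl)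
      rwa [← (isSec_den hW r hl).1 hs]
  · rintro rfl
    constructor
    · intro Q hQ u hu
      obtain ⟨r, rfl⟩ := (h.mem_iff hW).1 hQ
      obtain ⟨l, hl, rfl⟩ := hW.exists_enc hu
      exact ⟨_, mem_defSetA.2 ⟨r, l, hl, rfl⟩, (isSec_den hW r hl).2 rfl⟩
    · intro y hy
      obtain ⟨r, l, hl, rfl⟩ := mem_defSetA.1 hy
      exact ⟨_, (h.mem_iff hW).2 ⟨r, rfl⟩, _, hW.enc_mem hl, (isSec_den hW r hl).2 rfl⟩

theorem DefIn.eq {M : Set ZFSet.{0}} {X K : ZFSet.{0}} (h : DefIn M X K) : K = DefSetA ∅ X := by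
  obtain ⟨W, -, F, -, C, -, D, -, hW, hF, hK⟩ := h
  exact (isSecs_iff hW hF).1 hK

/-- A finite tuple of witnesses for `DefIn`. -/
theorem exists_defIn (X : ZFSet.{0}) : ∃ W F C D : ZFSet.{0}, ∀ M : Set ZFSet.{0},
    W ∈ M → F ∈ M → C ∈ M → D ∈ M → DefIn M X (DefSetA ∅ X) := by
  have hW := isLW_seqSet X
  have hF := isSF_range hW
  exact ⟨_, _, _, _, fun M h1 h2 h3 h4 =>
    ⟨_, h1, _, h2, _, h3, _, h4, hW, hF, (isSecs_iff hW hF).2 rfl⟩⟩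

/-! ### The constructible hierarchy -/

theorem mem_img {f : ZFSet.{0} → ZFSet.{0}} {x y : ZFSet.{0}} :
    y ∈ img f x ↔ ∃ z ∈ x, f z = y :=
  @ZFSet.mem_image f (Classical.allZFSetDefinable _) x y

theorem isOrd_iff {x : ZFSet.{0}} : IsOrd x ↔ x.IsOrdinal :=
  (isOrdinal_iff_forall_mem_isTransitive (x := x)).symm

theorem mem_Lstage {α x : ZFSet.{0}} :
    x ∈ Lstage α ↔ ∃ β ∈ α, x ∈ DefSetA ∅ (Lstage β) := by
  rw [Lstage, LstageA, WellFounded.fix_eq, mem_sUnion]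
  simp only [mem_img]
  constructor
  · rintro ⟨_, ⟨β, hβ, rfl⟩, hx⟩
    rw [dif_pos hβ] at hx
    exact ⟨β, hβ, hx⟩
  · rintro ⟨β, hβ, hx⟩
    exact ⟨_, ⟨β, hβ, rfl⟩, by rwa [dif_pos hβ]⟩

theorem self_mem_defSetA (X : ZFSet.{0}) : X ∈ DefSetA ∅ X := by
  refine mem_defSetA.2 ⟨.neg .zero, [], by simp, ?_⟩
  ext z
  simp [RC.holds_neg, RC.holds]

theorem subset_of_mem_defSetA {X y : ZFSet.{0}} (h : y ∈ DefSetA ∅ X) : y ⊆ X :=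
  mem_powerset.1 (mem_sep.1 h).1

theorem subset_defSetA {X : ZFSet.{0}} (h : X.IsTransitive) : X ⊆ DefSetA ∅ X := by
  intro a ha
  refine mem_defSetA.2 ⟨.op .mem .zero .zero, [a], by simpa, ?_⟩
  ext z
  simp only [mem_sep, RC.holds, OpL]
  exact ⟨fun hz => ⟨h _ ha hz, hz⟩, fun hz => hz.2⟩

theorem isTransitive_Lstage (α : ZFSet.{0}) : (Lstage α).IsTransitive := by
  induction α using ZFSet.inductionOn with
  | h α ih =>
    intro y hy z hz
    obtain ⟨β, hβ, hy⟩ := mem_Lstage.1 hy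
    exact mem_Lstage.2 ⟨β, hβ, subset_defSetA (ih β hβ) (subset_of_mem_defSetA hy hz)⟩

theorem Lstage_mem {α β : ZFSet.{0}} (h : β ∈ α) : Lstage β ∈ Lstage α :=
  mem_Lstage.2 ⟨β, h, self_mem_defSetA _⟩

theorem defSetA_Lstage_subset {α β : ZFSet.{0}} (h : β ∈ α) :
    DefSetA ∅ (Lstage β) ⊆ Lstage α :=
  fun _ hx => mem_Lstage.2 ⟨β, h, hx⟩

theorem mem_of_Lstage_mem {α β : ZFSet.{0}} (hα : IsOrd α) (hβ : IsOrd β)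
    (h : Lstage β ∈ Lstage α) : β ∈ α := by
  rcases (isOrd_iff.1 hα).mem_or_subset (isOrd_iff.1 hβ) with h' | h'
  · exact (mem_asymm h (Lstage_mem h')).elim
  · rcases (isOrd_iff.1 hα).mem_trichotomous (isOrd_iff.1 hβ) with h'' | rfl | h''
    · exact (mem_asymm h (Lstage_mem h'')).elim
    · exact (ZFSet.mem_irrefl _ h).elim
    · exact h''

theorem IsOrd.mem {α β : ZFSet.{0}} (hα : IsOrd α) (h : β ∈ α) : IsOrd β :=
  isOrd_iff.2 ((isOrd_iff.1 hα).mem h)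

theorem isOrd_insert {δ : ZFSet.{0}} (hδ : IsOrd δ) : IsOrd (insert δ δ) := by
  constructor
  · intro y hy z hz
    rw [mem_insert_iff] at hy ⊢
    rcases hy with rfl | hy
    · exact .inr hz
    · exact .inr (hδ.1 _ hy hz)
  · intro y hy
    rcases mem_insert_iff.1 hy with rfl | hy
    exacts [hδ.1, hδ.2 y hy]

theorem isOrd_sUnion {A : ZFSet.{0}} (h : ∀ x ∈ A, IsOrd x) : IsOrd (sUnion A) := by
  constructor
  · intro y hy z hz
    obtain ⟨x, hx, hy⟩ := mem_sUnion.1 hy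
    exact mem_sUnion.2 ⟨x, hx, (h x hx).1 _ hy hz⟩
  · intro y hy
    obtain ⟨x, hx, hy⟩ := mem_sUnion.1 hy
    exact (h x hx).2 y hy

theorem StgIn.exists_eq_Lstage {M : Set ZFSet.{0}} {s : ZFSet.{0}} (h : StgIn M s)
    {X : ZFSet.{0}} (hX : X ∈ s) : ∃ α, IsOrd α ∧ X = Lstage α := by
  induction X using ZFSet.inductionOn with
  | h X ih =>
    obtain ⟨h1, h2⟩ := h X hX
    have h1 : ∀ Z ∈ s, Z ∈ X → DefSetA ∅ Z ⊆ X := fun Z hZ hZX => by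
      obtain ⟨K, -, hK, hKX⟩ := h1 Z hZ hZX
      exact hK.eq ▸ hKX
    have h2 : ∀ y ∈ X, ∃ Z ∈ s, Z ∈ X ∧ y ∈ DefSetA ∅ Z := fun y hy => by
      obtain ⟨Z, hZ, hZX, K, -, hK, hy⟩ := h2 y hy
      exact ⟨Z, hZ, hZX, hK.eq ▸ hy⟩
    choose! β hβ hZ using ih
    refine ⟨sUnion (img (fun Z => insert (β Z) (β Z)) (ZFSet.sep (· ∈ s) X)),
      isOrd_sUnion ?_, ?_⟩
    · simp only [mem_img, mem_sep]
      rintro _ ⟨Z, ⟨hZX, hZs⟩, rfl⟩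
      exact isOrd_insert (hβ Z hZX hZs)
    · ext y
      simp only [mem_Lstage, mem_sUnion, mem_img, mem_sep]
      constructor
      · intro hy
        obtain ⟨Z, hZs, hZX, hy⟩ := h2 y hy
        exact ⟨β Z, ⟨_, ⟨Z, ⟨hZX, hZs⟩, rfl⟩, mem_insert_iff.2 (.inl rfl)⟩, hZ Z hZX hZs ▸ hy⟩
      · rintro ⟨ξ, ⟨_, ⟨Z, ⟨hZX, hZs⟩, rfl⟩, hξ⟩, hy⟩
        rcases mem_insert_iff.1 hξ with rfl | hξ
        · rw [← hZ Z hZX hZs] at hy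
          exact h1 Z hZs hZX hy
        · have hZt : Z.IsTransitive := by
            rw [hZ Z hZX hZs]; exact isTransitive_Lstage _
          refine h1 Z hZs hZX (subset_defSetA hZt ?_)
          rw [hZ Z hZX hZs]
          exact defSetA_Lstage_subset hξ hy

theorem InLIn.mem_LClass {M : Set ZFSet.{0}} {f : ZFSet.{0}} (h : InLIn M f) : f ∈ LClass := by
  obtain ⟨s, -, ⟨X, hX, hf⟩, hs⟩ := h
  obtain ⟨α, hα, rfl⟩ := hs.exists_eq_Lstage hX
  exact ⟨α, hα, hf⟩

theorem exists_forall_inLIn {f : ZFSet.{0}} (hf : f ∈ LClass) :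
    ∃ P : ZFSet.{0}, ∀ M : TClass, P ∈ M.1 → InLIn M.1 f := by
  obtain ⟨δ, hδ, hf⟩ := hf
  choose W F C D hdef using exists_defIn
  have hδ' := isOrd_insert hδ
  set s := img Lstage (insert δ δ) with hs
  have mem_s : ∀ β ∈ (insert δ δ : ZFSet.{0}), Lstage β ∈ s := fun β hβ => mem_img.2 ⟨β, hβ, rfl⟩
  refine ⟨{s} ∪ (img W s ∪ (img F s ∪ (img C s ∪ (img D s ∪ img (DefSetA ∅) s)))),
    fun M hP => ?_⟩
  have hsub := M.2 _ hP
  simp only [mem_union, mem_singleton] at hsub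
  have hdefM : ∀ Z ∈ s, DefIn M.1 Z (DefSetA ∅ Z) ∧ DefSetA ∅ Z ∈ M.1 := fun Z hZ => by
    have key : ∀ g : ZFSet.{0} → ZFSet.{0}, g Z ∈ img g s := fun g => mem_img.2 ⟨Z, hZ, rfl⟩
    exact ⟨hdef Z M.1 (hsub _ (by simp [key])) (hsub _ (by simp [key])) (hsub _ (by simp [key]))
      (hsub _ (by simp [key])), hsub _ (by simp [key])⟩
  refine ⟨s, hsub s (.inl rfl), ⟨_, mem_s δ (mem_insert_iff.2 (.inl rfl)), hf⟩, ?_⟩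
  intro X hX
  obtain ⟨α, hα, rfl⟩ := mem_img.1 hX
  constructor
  · intro Z hZ hZX
    refine ⟨_, (hdefM Z hZ).2, (hdefM Z hZ).1, ?_⟩
    obtain ⟨ξ, hξ, rfl⟩ := mem_img.1 hZ
    exact defSetA_Lstage_subset (mem_of_Lstage_mem (hδ'.mem hα) (hδ'.mem hξ) hZX)
  · intro y hy
    obtain ⟨ξ, hξ, hy⟩ := mem_Lstage.1 hy
    have hξ' := mem_s ξ (hδ'.1 _ hα hξ)
    exact ⟨_, hξ', Lstage_mem hξ, _, (hdefM _ hξ').2, (hdefM _ hξ').1, hy⟩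

theorem DefIn.mono {M N : Set ZFSet.{0}} (h : M ⊆ N) {X K : ZFSet.{0}} :
    DefIn M X K → DefIn N X K := fun ⟨W, hW, F, hF, C, hC, D, hD, h'⟩ =>
  ⟨W, h hW, F, h hF, C, h hC, D, h hD, h'⟩

theorem StgIn.mono {M N : Set ZFSet.{0}} (h : M ⊆ N) {s : ZFSet.{0}} (hs : StgIn M s) :
    StgIn N s := fun X hX =>
  ⟨fun Z hZ hZX => let ⟨K, hK, hd, hKX⟩ := (hs X hX).1 Z hZ hZX
    ⟨K, h hK, hd.mono h, hKX⟩,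
   fun y hy => let ⟨Z, hZ, hZX, K, hK, hd, hyK⟩ := (hs X hX).2 y hy
    ⟨Z, hZ, hZX, K, h hK, hd.mono h, hyK⟩⟩

theorem InLIn.mono {M N : Set ZFSet.{0}} (h : M ⊆ N) {f : ZFSet.{0}} :
    InLIn M f → InLIn N f := fun ⟨s, hs, hf, hst⟩ => ⟨s, h hs, hf, hst.mono h⟩

/-! ### Elementary submodels -/

theorem sat_ex {S : Set ZFSet.{0}} {n : ℕ} {φ : Fml (n + 1)} {v : Fin n → ZFSet.{0}} :
    Sat S (.ex φ) v ↔ ∃ x ∈ S, Sat S φ (Fin.cons x v) := Iff.rfl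

theorem forall_cons {P : ZFSet.{0} → Prop} {n : ℕ} {x : ZFSet.{0}} {v : Fin n → ZFSet.{0}}
    (hx : P x) (hv : ∀ i, P (v i)) :
    ∀ i, P ((Fin.cons x v : Fin (n + 1) → ZFSet.{0}) i) := by
  intro i
  refine Fin.cases ?_ (fun j => ?_) i
  · simpa using hx
  · simpa using hv j

/-- The Tarski–Vaught criterion. -/
theorem elemSub_of_witness {Y : ZFSet.{0}} {S : Set ZFSet.{0}} (hYS : Y.toSet ⊆ S)
    (h : ∀ {n : ℕ} (φ : Fml (n + 1)) (v : Fin n → ZFSet.{0}), (∀ i, v i ∈ Y) →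
      (∃ x ∈ S, Sat S φ (Fin.cons x v)) → ∃ x ∈ Y, Sat S φ (Fin.cons x v)) :
    ElemSub Y S := by
  refine ⟨hYS, fun φ => ?_⟩
  induction φ with
  | mem i j => intro v _; exact Iff.rfl
  | eq i j => intro v _; exact Iff.rfl
  | inA i => intro v _; exact Iff.rfl
  | inB i => intro v _; exact Iff.rfl
  | not φ ih => intro v hv; exact not_congr (ih v hv)
  | and φ ψ ih₁ ih₂ => intro v hv; exact and_congr (ih₁ v hv) (ih₂ v hv)
  | ex φ ih =>
    intro v hv
    rw [sat_ex, sat_ex]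
    constructor
    · rintro ⟨x, hx, hs⟩
      exact ⟨x, hYS hx, (ih _ (forall_cons (P := (· ∈ Y)) hx hv)).1 hs⟩
    · intro hs
      obtain ⟨x, hx, hs⟩ := h φ v hv hs
      exact ⟨x, hx, (ih _ (forall_cons (P := (· ∈ Y)) hx hv)).2 hs⟩

theorem ElemSub.exists_witness {Y : ZFSet.{0}} {S : Set ZFSet.{0}} (hY : ElemSub Y S) {n : ℕ}
    (φ : Fml (n + 1)) (v : Fin n → ZFSet.{0}) (hv : ∀ i, v i ∈ Y)
    (h : ∃ x ∈ S, Sat S φ (Fin.cons x v)) : ∃ x ∈ Y, Sat S φ (Fin.cons x v) := by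
  obtain ⟨x, hx, hs⟩ := sat_ex.1 ((hY.2 (.ex φ) v hv).2 (sat_ex.2 h))
  exact ⟨x, hx, (hY.2 φ _ (forall_cons (P := (· ∈ Y)) hx hv)).1 hs⟩

theorem codeF_injective : ∀ {n : ℕ}, Function.Injective (codeF (n := n)) := by
  intro n φ
  induction φ with
  | mem i j => intro ψ h; cases ψ <;> simp_all [codeF, Nat.pair_eq_pair, Fin.ext_iff]
  | eq i j => intro ψ h; cases ψ <;> simp_all [codeF, Nat.pair_eq_pair, Fin.ext_iff]
  | inA i => intro ψ h; cases ψ <;> simp_all [codeF, Nat.pair_eq_pair, Fin.ext_iff]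
  | inB i => intro ψ h; cases ψ <;> simp_all [codeF, Nat.pair_eq_pair, Fin.ext_iff]
  | not φ ih =>
    intro ψ h
    cases ψ <;> simp [codeF, Nat.pair_eq_pair] at h
    rw [ih h]
  | and φ φ' ih ih' =>
    intro ψ h
    cases ψ <;> simp [codeF, Nat.pair_eq_pair] at h
    rw [ih h.1, ih' h.2]
  | ex φ ih =>
    intro ψ h
    cases ψ <;> simp [codeF, Nat.pair_eq_pair] at h
    rw [ih h]

instance {n : ℕ} : Countable (Fml n) := codeF_injective.countable

/-- One step of closing `B` under Skolem functions for `S`. -/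
def skolemStep (S B : Set ZFSet.{0}) : Set ZFSet.{0} :=
  B ∪ ⋃ p : Σ n, Fml (n + 1), ⋃ v : Fin p.1 → B,
    {x | ∃ h : ∃ x ∈ S, Sat S p.2 (Fin.cons x fun i => (v i : ZFSet.{0})), x = h.choose}

theorem skolemStep_subset {S B : Set ZFSet.{0}} (h : B ⊆ S) : skolemStep S B ⊆ S := by
  rintro x (hx | hx)
  · exact h hx
  · simp only [Set.mem_iUnion] at hx
    obtain ⟨p, v, hex, rfl⟩ := hx
    exact hex.choose_spec.1

theorem skolemStep_countable {S B : Set ZFSet.{0}} (h : B.Countable) :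
    (skolemStep S B).Countable := by
  have := h.to_subtype
  refine h.union (Set.countable_iUnion fun p => Set.countable_iUnion fun v => ?_)
  refine Set.Subsingleton.countable ?_
  rintro x ⟨_, rfl⟩ y ⟨_, rfl⟩
  rfl

theorem exists_toSet_eq_of_countable {B : Set ZFSet.{0}} (h : B.Countable) :
    ∃ Y : ZFSet.{0}, Y.toSet = B := by
  have := h.to_subtype
  refine ⟨ZFSet.range (fun x : B => (x : ZFSet.{0})), ?_⟩
  ext x
  change x ∈ ZFSet.range _ ↔ _
  simp

/-- The downward Löwenheim–Skolem theorem. -/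
theorem exists_elemSub {S A : Set ZFSet.{0}} (hAS : A ⊆ S) (hA : A.Countable) :
    ∃ Y : ZFSet.{0}, A ⊆ Y.toSet ∧ Ctbl Y ∧ ElemSub Y S := by
  let B : ℕ → Set ZFSet.{0} := fun n => (skolemStep S)^[n] A
  have hsucc : ∀ n, B (n + 1) = skolemStep S (B n) := fun n =>
    Function.iterate_succ_apply' (skolemStep S) n A
  have hmono : Monotone B := monotone_nat_of_le_succ fun n => by
    rw [hsucc]; exact Set.subset_union_left
  have hS : ∀ n, B n ⊆ S := by
    intro n
    induction n with
    | zero => exact hAS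
    | succ n ih => rw [hsucc]; exact skolemStep_subset ih
  have hc : ∀ n, (B n).Countable := by
    intro n
    induction n with
    | zero => exact hA
    | succ n ih => rw [hsucc]; exact skolemStep_countable ih
  obtain ⟨Y, hY⟩ := exists_toSet_eq_of_countable (Set.countable_iUnion hc)
  have hmem : ∀ {x}, x ∈ Y ↔ ∃ n, x ∈ B n := fun {x} => by
    rw [← Set.mem_iUnion, ← hY]; rfl
  refine ⟨Y, ?_, ?_, elemSub_of_witness ?_ ?_⟩
  · intro x hx; exact hmem.2 ⟨0, hx⟩
  · rw [Ctbl, hY]; exact Set.countable_iUnion hc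
  · rw [hY]; exact Set.iUnion_subset hS
  · intro n φ v hv h
    choose k hk using fun i => hmem.1 (hv i)
    obtain ⟨m, hm⟩ := (Set.finite_range k).bddAbove
    have hvm : ∀ i, v i ∈ B m := fun i => hmono (hm ⟨i, rfl⟩) (hk i)
    refine ⟨h.choose, hmem.2 ⟨m + 1, ?_⟩, h.choose_spec.2⟩
    rw [hsucc]
    refine Or.inr ?_
    simp only [Set.mem_iUnion]
    exact ⟨⟨n, φ⟩, fun i => ⟨v i, hvm i⟩, h, rfl⟩

theorem natZ_mem_omega (n : ℕ) : natZ n ∈ ZFSet.omega := by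
  induction n with
  | zero => exact omega_zero
  | succ n ih => exact omega_succ ih

theorem natZ_mem_natZ {m n : ℕ} (h : m < n) : natZ m ∈ natZ n := by
  induction n with
  | zero => omega
  | succ n ih =>
    rw [natZ, mem_insert_iff]
    rcases Nat.lt_succ_iff_lt_or_eq.1 h with h | rfl
    · exact Or.inr (ih h)
    · exact Or.inl rfl

theorem natZ_injective : Function.Injective natZ := by
  intro m n h
  by_contra hne
  rcases Nat.lt_or_gt_of_ne hne with hl | hl
  · exact mem_irrefl _ (h ▸ natZ_mem_natZ hl)
  · exact mem_irrefl _ (h ▸ natZ_mem_natZ hl)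

theorem zfToNat_natZ (n : ℕ) : zfToNat (natZ n) = n := by
  have h : ∃ m : ℕ, natZ m = natZ n := ⟨n, rfl⟩
  rw [zfToNat, dif_pos h]
  exact natZ_injective h.choose_spec

theorem mem_seqUnion {f : ℕ → ZFSet.{0}} {x : ZFSet.{0}} :
    x ∈ seqUnion f ↔ ∃ n, x ∈ f n := by
  simp only [seqUnion, mem_sUnion, mem_img]
  constructor
  · rintro ⟨_, ⟨z, _, rfl⟩, hx⟩
    exact ⟨_, hx⟩
  · rintro ⟨n, hx⟩
    exact ⟨f n, ⟨natZ n, natZ_mem_omega n, by rw [zfToNat_natZ]⟩, hx⟩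

theorem elemSub_seqUnion {S : Set ZFSet.{0}} {f : ℕ → ZFSet.{0}} (hf : ∀ n, ElemSub (f n) S)
    (hmono : ∀ n, f n ⊆ f (n + 1)) : ElemSub (seqUnion f) S := by
  have hm : ∀ {m n : ℕ}, m ≤ n → ∀ {x}, x ∈ f m → x ∈ f n := by
    intro m n h
    induction h with
    | refl => exact fun hx => hx
    | step _ ih => exact fun hx => hmono _ (ih hx)
  refine elemSub_of_witness ?_ ?_
  · intro x hx
    obtain ⟨n, hn⟩ := mem_seqUnion.1 hx
    exact (hf n).1 hn
  · intro n φ v hv h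
    choose k hk using fun i => mem_seqUnion.1 (hv i)
    obtain ⟨m, hkm⟩ := (Set.finite_range k).bddAbove
    obtain ⟨x, hx, hs⟩ := (hf m).exists_witness φ v (fun i => hm (hkm ⟨i, rfl⟩) (hk i)) h
    exact ⟨x, mem_seqUnion.2 ⟨m, hx⟩, hs⟩

theorem ctblInf_seqUnion {f : ℕ → ZFSet.{0}} (hf : ∀ n, CtblInf (f n)) :
    CtblInf (seqUnion f) := by
  have h : (seqUnion f).toSet = ⋃ n, (f n).toSet := by
    ext x
    rw [Set.mem_iUnion]
    exact mem_seqUnion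
  refine ⟨?_, ?_⟩
  · rw [h]; exact Set.countable_iUnion fun n => (hf n).1
  · rw [h]; exact (hf 0).2.mono (Set.subset_iUnion (fun n => (f n).toSet) 0)

/-- The countable elementary submodels of `S` containing `a` form a club. -/
theorem clubSub_elemSub {S : Set ZFSet.{0}} {a : ZFSet.{0}} (ha : a ∈ S) :
    ClubSub S {X | ElemSub X S ∧ CtblInf X ∧ a ∈ X} := by
  refine ⟨fun X hX => ⟨hX.1.1, hX.2.1⟩, fun X hXS hX => ?_, fun f hf hm => ?_⟩
  · obtain ⟨Y, hY, hYc, hYe⟩ := exists_elemSub (S := S) (A := insert a X.toSet)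
      (Set.insert_subset ha hXS) (hX.1.insert a)
    exact ⟨Y, ⟨hYe, ⟨hYc, hX.2.mono ((Set.subset_insert _ _).trans hY)⟩,
      hY (Set.mem_insert _ _)⟩, fun x hx => hY (Set.mem_insert_of_mem _ hx)⟩
  · exact ⟨elemSub_seqUnion (fun n => (hf n).1) hm, ctblInf_seqUnion fun n => (hf n).2.1,
      mem_seqUnion.2 ⟨0, (hf 0).2.2⟩⟩

/-! ### Transitive collapses -/

theorem mem_collapse {X y w : ZFSet.{0}} :
    w ∈ collapse X y ↔ ∃ z ∈ y, z ∈ X ∧ collapse X z = w := by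
  rw [collapse, WellFounded.fix_eq, mem_img]
  constructor
  · rintro ⟨z, hz, rfl⟩
    obtain ⟨hzy, hzX⟩ := mem_sep.1 hz
    exact ⟨z, hzy, hzX, by rw [dif_pos hzy]⟩
  · rintro ⟨z, hzy, hzX, rfl⟩
    exact ⟨z, mem_sep.2 ⟨hzy, hzX⟩, by rw [dif_pos hzy]⟩

theorem collapse_mem {X y z : ZFSet.{0}} (h : z ∈ y) (hz : z ∈ X) :
    collapse X z ∈ collapse X y := mem_collapse.2 ⟨z, h, hz, rfl⟩

theorem isOrd_collapse {X α : ZFSet.{0}} (hα : IsOrd α) : IsOrd (collapse X α) := by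
  induction α using ZFSet.inductionOn with
  | _ α ih =>
    constructor
    · intro w hw u hu
      obtain ⟨z, hz, hzX, rfl⟩ := mem_collapse.1 hw
      obtain ⟨z', hz', hzX', rfl⟩ := mem_collapse.1 hu
      exact collapse_mem (hα.1 _ hz hz') hzX'
    · intro w hw
      obtain ⟨z, hz, hzX, rfl⟩ := mem_collapse.1 hw
      exact (ih z hz (hα.mem hz)).1

theorem collapse_mem_iff {X α β : ZFSet.{0}} (hα : IsOrd α) (hβ : IsOrd β) (hαX : α ∈ X)
    (hβX : β ∈ X) : collapse X α ∈ collapse X β ↔ α ∈ β := by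
  refine ⟨fun h => ?_, fun h => collapse_mem h hαX⟩
  rcases (isOrd_iff.1 hα).mem_trichotomous (isOrd_iff.1 hβ) with h' | h' | h'
  · exact h'
  · subst h'
    exact (mem_irrefl _ h).elim
  · exact (mem_asymm h (collapse_mem h' hβX)).elim

theorem collapse_injOn {X α β : ZFSet.{0}} (hα : IsOrd α) (hβ : IsOrd β) (hαX : α ∈ X)
    (hβX : β ∈ X) (h : collapse X α = collapse X β) : α = β := by
  rcases (isOrd_iff.1 hα).mem_trichotomous (isOrd_iff.1 hβ) with h' | h' | h'
  · exact (mem_irrefl _ (h ▸ collapse_mem h' hαX)).elim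
  · exact h'
  · exact (mem_irrefl _ (h ▸ collapse_mem h' hβX)).elim

theorem eq_of_equiv {α β : ZFSet.{0}} (hα : α.IsTransitive) (hβ : β.IsTransitive)
    (e : α.toSet ≃ β.toSet)
    (he : ∀ a b : α.toSet, (a : ZFSet.{0}) ∈ (b : ZFSet.{0}) ↔
      ((e a : ZFSet.{0}) ∈ (e b : ZFSet.{0}))) : α = β := by
  have key : ∀ x, ∀ hx : x ∈ α, (e ⟨x, hx⟩ : ZFSet.{0}) = x := by
    intro x
    induction x using ZFSet.inductionOn with
    | _ x ih =>
      intro hx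
      ext w
      constructor
      · intro hw
        obtain ⟨⟨b, hb⟩, hbw⟩ := e.surjective ⟨w, hβ _ (e ⟨x, hx⟩).2 hw⟩
        have hbx : b ∈ x := (he ⟨b, hb⟩ ⟨x, hx⟩).2 (by rw [hbw]; exact hw)
        have := ih b hbx hb
        rw [hbw] at this
        exact (show w = b from this) ▸ hbx
      · intro hw
        have := (he ⟨w, hα _ hx hw⟩ ⟨x, hx⟩).1 hw
        rwa [ih w hw] at this
  ext x
  constructor
  · intro hx
    have := (e ⟨x, hx⟩).2
    rwa [key] at this
  · intro hx
    obtain ⟨⟨b, hb⟩, hbx⟩ := e.surjective ⟨x, hx⟩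
    have := key b hb
    rw [hbx] at this
    exact (show x = b from this) ▸ hb

theorem otype_eq {Y α : ZFSet.{0}} (hα : IsOrd α) (e : Y.toSet ≃ α.toSet)
    (he : ∀ a b : Y.toSet, (a : ZFSet.{0}) ∈ (b : ZFSet.{0}) ↔
      ((e a : ZFSet.{0}) ∈ (e b : ZFSet.{0}))) : otype Y = α := by
  have h : ∃ α, IsOrd α ∧ ∃ e : Y.toSet ≃ α.toSet,
      ∀ a b : Y.toSet, (a : ZFSet.{0}) ∈ (b : ZFSet.{0}) ↔
        ((e a : ZFSet.{0}) ∈ (e b : ZFSet.{0})) := ⟨α, hα, e, he⟩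
  rw [otype, dif_pos h]
  obtain ⟨h₁, e', he'⟩ := h.choose_spec
  refine eq_of_equiv h₁.1 hα.1 (e'.symm.trans e) fun a b => ?_
  have := he' (e'.symm a) (e'.symm b)
  simp only [Equiv.apply_symm_apply] at this
  rw [← this]
  exact he _ _

theorem otype_inter {X γ : ZFSet.{0}} (hγ : IsOrd γ) : otype (X ∩ γ) = collapse X γ := by
  have hmem : ∀ a : (X ∩ γ).toSet, (a : ZFSet.{0}) ∈ X ∧ (a : ZFSet.{0}) ∈ γ := fun a =>
    mem_inter.1 a.2
  let f : (X ∩ γ).toSet → (collapse X γ).toSet := fun a =>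
    ⟨collapse X a, collapse_mem (hmem a).2 (hmem a).1⟩
  have hf : Function.Bijective f := by
    constructor
    · intro a b h
      exact Subtype.ext (collapse_injOn (hγ.mem (hmem a).2) (hγ.mem (hmem b).2) (hmem a).1
        (hmem b).1 (congrArg Subtype.val h))
    · rintro ⟨w, hw⟩
      obtain ⟨z, hz, hzX, rfl⟩ := mem_collapse.1 hw
      exact ⟨⟨z, mem_inter.2 ⟨hzX, hz⟩⟩, rfl⟩
  refine otype_eq (isOrd_collapse hγ) (Equiv.ofBijective f hf) fun a b => ?_
  exact (collapse_mem_iff (hγ.mem (hmem a).2) (hγ.mem (hmem b).2) (hmem a).1 (hmem b).1).symm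

theorem ElemSub.exists_mem_not_iff {N : ZFSet.{0}} {T : Set ZFSet.{0}} (hN : ElemSub N T)
    (hT : ∀ x ∈ T, ∀ y ∈ x, y ∈ T) {x y : ZFSet.{0}} (hx : x ∈ N) (hy : y ∈ N) (hne : x ≠ y) :
    ∃ z ∈ N, ¬ (z ∈ x ↔ z ∈ y) := by
  have hsat : ∀ z, Sat T (.not (.iff (.mem 0 1) (.mem 0 2))) (Fin.cons z ![x, y]) ↔
      ¬ (z ∈ x ↔ z ∈ y) := by
    intro z
    rw [iff_iff_implies_and_implies (a := z ∈ x)]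
    simp only [Sat, SatAB, Fml.iff, Fml.imp, not_and, not_not]
    exact Iff.rfl
  obtain ⟨z, hz, h⟩ := hN.exists_witness (.not (.iff (.mem 0 1) (.mem 0 2))) ![x, y]
    (by simp [Fin.forall_fin_two, hx, hy]) (by
      obtain ⟨z, hz⟩ := not_forall.1 fun h => hne (ZFSet.ext h)
      refine ⟨z, ?_, (hsat z).2 hz⟩
      by_cases hzx : z ∈ x
      · exact hT _ (hN.1 hx) _ hzx
      · exact hT _ (hN.1 hy) _ (by tauto))
  exact ⟨z, hz, (hsat z).1 h⟩

theorem ElemSub.collapse_injOn {N : ZFSet.{0}} {T : Set ZFSet.{0}} (hN : ElemSub N T)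
    (hT : ∀ x ∈ T, ∀ y ∈ x, y ∈ T) {x y : ZFSet.{0}} (hx : x ∈ N) (hy : y ∈ N)
    (h : collapse N x = collapse N y) : x = y := by
  induction x using ZFSet.inductionOn generalizing y with
  | _ x ih =>
    by_contra hne
    obtain ⟨z, hz, hzxy⟩ := hN.exists_mem_not_iff hT hx hy hne
    by_cases hzx : z ∈ x
    · obtain ⟨z', hz', hzN', he⟩ := mem_collapse.1 (h ▸ collapse_mem hzx hz)
      have := ih z hzx hz hzN' he.symm
      subst this
      tauto
    · have hzy : z ∈ y := by tauto
      obtain ⟨z', hz', hzN', he⟩ := mem_collapse.1 (h ▸ collapse_mem hzy hz)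
      have := ih z' hz' hzN' hz he
      subst this
      tauto

theorem mem_collapseSet {N w : ZFSet.{0}} :
    w ∈ collapseSet N ↔ ∃ x ∈ N, collapse N x = w := mem_img

theorem isTransitive_collapseSet (N : ZFSet.{0}) : (collapseSet N).IsTransitive := by
  intro w hw u hu
  obtain ⟨x, hx, rfl⟩ := mem_collapseSet.1 hw
  obtain ⟨z, _, hz, rfl⟩ := mem_collapse.1 hu
  exact mem_collapseSet.2 ⟨z, hz, rfl⟩

theorem ElemSub.sat_collapseSet {N : ZFSet.{0}} {T : Set ZFSet.{0}} (hN : ElemSub N T)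
    (hT : ∀ x ∈ T, ∀ y ∈ x, y ∈ T) {n : ℕ} (φ : Fml n) (v : Fin n → ZFSet.{0})
    (hv : ∀ i, v i ∈ N) :
    Sat (collapseSet N).toSet φ (fun i => collapse N (v i)) ↔ Sat N.toSet φ v := by
  induction φ with
  | mem i j =>
    refine ⟨fun h => ?_, fun h => collapse_mem h (hv i)⟩
    obtain ⟨z, hz, hzN, he⟩ := mem_collapse.1 h
    have := hN.collapse_injOn hT hzN (hv i) he
    subst this
    exact hz
  | eq i j => exact ⟨fun h => hN.collapse_injOn hT (hv i) (hv j) h, fun h => congrArg _ h⟩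
  | inA i => exact Iff.rfl
  | inB i => exact Iff.rfl
  | not φ ih => exact not_congr (ih v hv)
  | and φ ψ ih₁ ih₂ => exact and_congr (ih₁ v hv) (ih₂ v hv)
  | @ex n φ ih =>
    have hc : ∀ x, (Fin.cons (collapse N x) fun i => collapse N (v i)) =
        fun i => collapse N ((Fin.cons x v : Fin (n + 1) → ZFSet.{0}) i) := by
      intro x
      funext i
      refine Fin.cases ?_ (fun j => ?_) i <;> simp
    rw [sat_ex, sat_ex]
    constructor
    · rintro ⟨w, hw, hs⟩
      obtain ⟨x, hx, rfl⟩ := mem_collapseSet.1 hw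
      rw [hc] at hs
      exact ⟨x, hx, (ih _ (forall_cons (P := (· ∈ N)) hx hv)).1 hs⟩
    · rintro ⟨x, hx, hs⟩
      refine ⟨_, mem_collapseSet.2 ⟨x, hx, rfl⟩, ?_⟩
      rw [hc]
      exact (ih _ (forall_cons (P := (· ∈ N)) hx hv)).2 hs

theorem collapse_eq_self {N t x : ZFSet.{0}} (ht : t.IsTransitive) (htN : t ⊆ N) (hx : x ∈ t) :
    collapse N x = x := by
  induction x using ZFSet.inductionOn with
  | _ x ih =>
    ext w
    rw [mem_collapse]
    constructor
    · rintro ⟨z, hz, _, rfl⟩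
      rwa [ih z hz (ht _ hx hz)]
    · intro hw
      exact ⟨w, hw, htN (ht _ hx hw), ih w hw (ht _ hx hw)⟩

/-- Membership in `L` of a hereditarily countable set is witnessed in a countable transitive
set. -/
theorem exists_countable_inLIn {f t : ZFSet.{0}} (hf : f ∈ LClass) (ht : t.IsTransitive)
    (htc : Ctbl t) (hft : f ∈ t) :
    ∃ M : ZFSet.{0}, M.IsTransitive ∧ Ctbl M ∧ InLIn M.toSet f := by
  obtain ⟨P, hP⟩ := exists_forall_inLIn hf
  let o := max (Order.succ P.rank) t.rank
  have hT : ∀ x ∈ (V_ o).toSet, ∀ y ∈ x, y ∈ (V_ o).toSet := fun x hx y hy =>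
    isTransitive_vonNeumann o x hx hy
  have hPT : P ∈ (V_ o).toSet := mem_vonNeumann.2 (lt_max_of_lt_left (Order.lt_succ _))
  have htT : t.toSet ⊆ (V_ o).toSet := fun x hx =>
    mem_vonNeumann.2 (lt_max_of_lt_right (rank_lt_of_mem hx))
  obtain ⟨N, htN, hNc, hN⟩ := exists_elemSub htT htc
  have hfN : f ∈ N := htN hft
  have hsat : Sat N.toSet (.inL 0 : Fml 1) (fun _ => f) := by
    rw [hN.2 _ _ fun _ => hfN]
    exact (satM_inL (M := ⟨_, hT⟩) (v := fun _ => ⟨f, htT hft⟩) 0).2 (hP ⟨_, hT⟩ hPT)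
  rw [← hN.sat_collapseSet hT _ _ fun _ => hfN, collapse_eq_self ht (fun x hx => htN hx) hft]
    at hsat
  have htr : ∀ x ∈ (collapseSet N).toSet, ∀ y ∈ x, y ∈ (collapseSet N).toSet :=
    fun x hx y hy => isTransitive_collapseSet N x hx hy
  have hfC : f ∈ (collapseSet N).toSet :=
    mem_collapseSet.2 ⟨f, hfN, collapse_eq_self ht (fun x hx => htN hx) hft⟩
  refine ⟨collapseSet N, isTransitive_collapseSet N, ?_,
    (satM_inL (M := ⟨_, htr⟩) (v := fun _ => ⟨f, hfC⟩) 0).1 hsat⟩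
  have : (collapseSet N).toSet = collapse N '' N.toSet := by
    ext w
    exact mem_collapseSet
  rw [Ctbl, this]
  exact hNc.image _

open Cardinal in
theorem mk_toSet (x : ZFSet.{0}) : #x.toSet = lift.{1} (card x) := cardinalMk_coe_sort

theorem eqNum_iff {x y : ZFSet.{0}} : EqNum x y ↔ card x = card y := by
  rw [EqNum, ← Cardinal.eq, mk_toSet, mk_toSet, Cardinal.lift_inj]

theorem cardLE_iff {x y : ZFSet.{0}} : CardLE x y ↔ card x ≤ card y := by
  rw [CardLE, ← Cardinal.le_def, mk_toSet, mk_toSet, Cardinal.lift_le]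

open Cardinal in
theorem ctbl_iff {x : ZFSet.{0}} : Ctbl x ↔ card x ≤ ℵ₀ := by
  rw [Ctbl, ← le_aleph0_iff_set_countable, mk_toSet, lift_le_aleph0]

open Cardinal in
theorem card_sUnion_le {x : ZFSet.{0}} {μ : Cardinal.{0}} (hμ : ℵ₀ ≤ μ) (hx : card x ≤ μ)
    (h : ∀ y ∈ x, card y ≤ μ) : card (sUnion x) ≤ μ := by
  have hU : (sUnion x).toSet = ⋃ y ∈ x.toSet, y.toSet := by
    ext z
    simp only [Set.mem_iUnion, exists_prop]
    exact mem_sUnion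
  rw [← lift_le.{1}, ← mk_toSet, hU]
  refine (mk_biUnion_le _ _).trans ?_
  rw [mk_toSet]
  refine (mul_le_mul' (lift_le.2 hx) (ciSup_le' fun y => ?_)).trans
    (mul_eq_self (aleph0_le_lift.2 hμ)).le
  rw [mk_toSet]
  exact lift_le.2 (h _ y.2)

theorem card_img_le (f : ZFSet.{0} → ZFSet.{0}) (x : ZFSet.{0}) : card (img f x) ≤ card x :=
  @card_image_le _ f (Classical.allZFSetDefinable _)

open Cardinal in
theorem card_seqSet_le {X : ZFSet.{0}} {μ : Cardinal.{0}} (hμ : ℵ₀ ≤ μ) (hX : card X ≤ μ) :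
    card (seqSet X) ≤ μ := by
  rw [← lift_le.{1}]
  have h₁ : lift.{1} (card (seqSet X)) ≤ lift.{0} #(List X) := lift_card_range_le
  rw [lift_uzero] at h₁
  refine h₁.trans ((mk_list_le_max _).trans (max_le (aleph0_le_lift.2 hμ) ?_))
  rw [cardinalMk_coe_sort]
  exact lift_le.2 hX

open Cardinal in
/-- Every ordinal belongs to some regular cardinal. -/
theorem exists_isRegular {α : ZFSet.{0}} (hα : IsOrd α) : ∃ κ, IsRegular κ ∧ α ∈ κ := by
  obtain ⟨a, rfl⟩ := isOrdinal_iff_mem_range_toZFSet.1 (isOrd_iff.1 hα)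
  set μ : Cardinal.{0} := max ℵ₀ a.card with hμ
  set κ := (Order.succ μ).ord.toZFSet with hκ
  have hcard : card κ = Order.succ μ := by rw [hκ, Ordinal.card_toZFSet, card_ord]
  have hlt : ∀ β ∈ κ, card β ≤ μ := by
    intro β hβ
    obtain ⟨b, hb, rfl⟩ := Ordinal.mem_toZFSet_iff.1 hβ
    rw [Ordinal.card_toZFSet]
    exact Order.lt_succ_iff.1 (lt_ord.1 hb)
  refine ⟨κ, ⟨⟨isOrd_iff.2 (isOrdinal_toZFSet _), fun β hβ h => ?_⟩, fun x hx hu => ?_⟩, ?_⟩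
  · have := hlt β hβ
    rw [eqNum_iff.1 h, hcard] at this
    exact this.not_gt (Order.lt_succ μ)
  · rw [eqNum_iff]
    refine (card_mono hx).antisymm ?_
    by_contra hlt'
    rw [not_le, hcard, Order.lt_succ_iff] at hlt'
    have hsub : κ ⊆ x ∪ sUnion x := by
      intro β hβ
      obtain ⟨γ, hγ, h | rfl⟩ := hu β hβ
      · exact mem_union.2 (.inr (mem_sUnion.2 ⟨γ, hγ, h⟩))
      · exact mem_union.2 (.inl hγ)
    have : card κ ≤ μ := calc
      card κ ≤ card x + card (sUnion x) := (card_mono hsub).trans card_union_le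
      _ ≤ μ + μ := add_le_add hlt' (card_sUnion_le (le_max_left _ _) hlt' fun y hy => hlt y (hx hy))
      _ = μ := add_eq_self (le_max_left _ _)
    rw [hcard] at this
    exact this.not_gt (Order.lt_succ μ)
  · rw [hκ, Ordinal.toZFSet_mem_toZFSet_iff, lt_ord, Order.lt_succ_iff]
    exact le_max_right _ _

theorem leastOrd_spec {p : ZFSet.{0} → Prop} (h : ∃ α, IsOrd α ∧ p α) :
    IsOrd (leastOrd p) ∧ p (leastOrd p) := by
  obtain ⟨α, hα, hmin⟩ := mem_wf.has_min {α | IsOrd α ∧ p α} h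
  have h' : ∃ α, (IsOrd α ∧ p α) ∧ ∀ β ∈ α, ¬ (IsOrd β ∧ p β) :=
    ⟨α, hα, fun β hβ hp => hmin β hp hβ⟩
  rw [leastOrd, dif_pos h']
  exact h'.choose_spec.1

theorem mem_omega_iff {x : ZFSet.{0}} : x ∈ ZFSet.omega ↔ ∃ n, x = natZ n := by
  have h : ∀ n : ℕ, mk (PSet.ofNat n) = natZ n := by
    intro n
    induction n with
    | zero => rfl
    | succ n ih => rw [natZ, ← ih]; rfl
  refine ⟨?_, fun ⟨n, hn⟩ => hn ▸ natZ_mem_omega n⟩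
  induction x using Quotient.inductionOn with
  | _ x =>
    rintro ⟨⟨n⟩, hn⟩
    exact ⟨n, (Quotient.sound hn).trans (h n)⟩

theorem isOrd_natZ (n : ℕ) : IsOrd (natZ n) := by
  induction n with
  | zero => exact ⟨fun y hy => (ZFSet.notMem_empty _ hy).elim,
      fun y hy => (ZFSet.notMem_empty _ hy).elim⟩
  | succ n ih => exact isOrd_insert ih

theorem isOrd_omega : IsOrd ZFSet.omega := by
  constructor
  · intro y hy
    obtain ⟨n, rfl⟩ := mem_omega_iff.1 hy
    induction n with
    | zero => exact fun z hz => (ZFSet.notMem_empty _ hz).elim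
    | succ n ih =>
      intro z hz
      rcases mem_insert_iff.1 hz with rfl | hz
      · exact natZ_mem_omega n
      · exact ih (natZ_mem_omega n) hz
  · intro y hy
    obtain ⟨n, rfl⟩ := mem_omega_iff.1 hy
    exact (isOrd_natZ n).1

theorem omega_mem_aleph_one : ZFSet.omega ∈ Aleph 1 := by
  obtain ⟨κ, hκ, h⟩ := exists_isRegular isOrd_omega
  exact (leastOrd_spec (p := fun κ => IsCard κ ∧ ZFSet.omega ∈ κ) ⟨κ, hκ.1.1, hκ.1, h⟩).2.2

theorem infinite_of_aleph_one {γ : ZFSet.{0}} (hγ : IsOrd γ) (h : Aleph 1 ∈ γ ∨ Aleph 1 = γ) :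
    γ.toSet.Infinite := by
  have hω : ZFSet.omega ∈ γ := by
    rcases h with h | rfl
    · exact hγ.1 _ h omega_mem_aleph_one
    · exact omega_mem_aleph_one
  exact Set.infinite_of_injective_forall_mem natZ_injective fun n => hγ.1 _ hω (natZ_mem_omega n)

/-! ### Sets hereditarily of cardinality at most `μ` -/

/-- The class of sets hereditarily of cardinality at most `μ`. -/
def HLe (μ : Cardinal.{0}) : Set ZFSet.{0} := {x | ∃ t, t.IsTransitive ∧ x ∈ t ∧ card t ≤ μ}

theorem HLe_subset_Hset {γ κ : ZFSet.{0}} (h : γ ∈ κ) : HLe (card γ) ⊆ Hset κ :=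
  fun _ ⟨t, ht, hx, hc⟩ => ⟨t, ht, hx, γ, h, cardLE_iff.2 hc⟩

theorem mem_of_mem_Hset {κ x y : ZFSet.{0}} (hx : x ∈ Hset κ) (hy : y ∈ x) : y ∈ Hset κ :=
  let ⟨t, ht, hxt, hc⟩ := hx
  ⟨t, ht, ht _ hxt hy, hc⟩

theorem mem_HLe_of_mem {μ : Cardinal.{0}} {x y : ZFSet.{0}} (hx : x ∈ HLe μ) (hy : y ∈ x) :
    y ∈ HLe μ :=
  let ⟨t, ht, hxt, hc⟩ := hx
  ⟨t, ht, ht _ hxt hy, hc⟩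

section HLe
open Cardinal
variable {μ : Cardinal.{0}}

theorem mem_HLe (hμ : ℵ₀ ≤ μ) {x : ZFSet.{0}} (hx : ∀ y ∈ x, y ∈ HLe μ) (hc : card x ≤ μ) : x ∈ HLe μ := by
  choose! t ht hyt hct using hx
  have htr : (sUnion (img t x)).IsTransitive := by
    intro z hz w hw
    obtain ⟨_, hu, hz⟩ := mem_sUnion.1 hz
    obtain ⟨y, hy, rfl⟩ := mem_img.1 hu
    exact mem_sUnion.2 ⟨_, mem_img.2 ⟨y, hy, rfl⟩, ht y hy _ hz hw⟩
  refine ⟨insert x (sUnion (img t x)), ?_, mem_insert _ _, ?_⟩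
  · intro z hz w hw
    rcases mem_insert_iff.1 hz with rfl | hz
    · exact mem_insert_of_mem _ (mem_sUnion.2 ⟨_, mem_img.2 ⟨w, hw, rfl⟩, hyt w hw⟩)
    · exact mem_insert_of_mem _ (htr _ hz hw)
  · refine card_insert_le.trans ((add_le_add (card_sUnion_le hμ ((card_img_le _ _).trans hc) ?_)
      (one_le_aleph0.trans hμ)).trans (add_eq_self hμ).le)
    intro _ hu
    obtain ⟨z, hz, rfl⟩ := mem_img.1 hu
    exact hct z hz

theorem mem_HLe_of_ctbl (hμ : ℵ₀ ≤ μ) {x : ZFSet.{0}} (hx : ∀ y ∈ x, y ∈ HLe μ) (hc : Ctbl x) : x ∈ HLe μ :=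
  mem_HLe hμ hx ((ctbl_iff.1 hc).trans hμ)

theorem mem_HLe_of_isTransitive (hμ : ℵ₀ ≤ μ) {t : ZFSet.{0}} (ht : t.IsTransitive) (hc : card t ≤ μ) :
    t ∈ HLe μ :=
  mem_HLe hμ (fun _ hy => ⟨t, ht, hy, hc⟩) hc

theorem upair_mem_HLe (hμ : ℵ₀ ≤ μ) {x y : ZFSet.{0}} (hx : x ∈ HLe μ) (hy : y ∈ HLe μ) :
    ({x, y} : ZFSet.{0}) ∈ HLe μ := by
  refine mem_HLe_of_ctbl hμ (by simp [hx, hy]) ?_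
  refine (Set.toFinite {x, y}).countable.mono fun z hz => ?_
  have : z ∈ ({x, y} : ZFSet.{0}) := hz
  simpa using this

theorem pair_mem_HLe (hμ : ℵ₀ ≤ μ) {x y : ZFSet.{0}} (hx : x ∈ HLe μ) (hy : y ∈ HLe μ) : pair x y ∈ HLe μ := by
  have h := upair_mem_HLe hμ hx hx
  rw [show ({x, x} : ZFSet.{0}) = {x} by ext; simp] at h
  exact upair_mem_HLe hμ h (upair_mem_HLe hμ hx hy)

theorem empty_mem_HLe (hμ : ℵ₀ ≤ μ) : (∅ : ZFSet.{0}) ∈ HLe μ :=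
  mem_HLe hμ (fun _ h => (ZFSet.notMem_empty _ h).elim) (by simp)

theorem enc_mem_HLe (hμ : ℵ₀ ≤ μ) {l : List ZFSet.{0}} (hl : ∀ x ∈ l, x ∈ HLe μ) : enc l ∈ HLe μ := by
  induction l with
  | nil => exact empty_mem_HLe hμ
  | cons x l ih => exact pair_mem_HLe hμ (hl _ (by simp)) (ih fun y hy => hl _ (by simp [hy]))

theorem seqSet_mem_HLe (hμ : ℵ₀ ≤ μ) {X : ZFSet.{0}} (hX : X ∈ HLe μ) (hc : card X ≤ μ) : seqSet X ∈ HLe μ := by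
  refine mem_HLe hμ (fun w hw => ?_) (card_seqSet_le hμ hc)
  obtain ⟨l, hl, rfl⟩ := mem_seqSet.1 hw
  exact enc_mem_HLe hμ fun x hx => mem_HLe_of_mem hX (hl x hx)

theorem img_pair_mem_HLe (hμ : ℵ₀ ≤ μ) {x : ZFSet.{0}} (hx : x ∈ HLe μ) (hc : card x ≤ μ)
    {f : ZFSet.{0} → ZFSet.{0}} (hf : ∀ y ∈ x, f y ∈ HLe μ) :
    img (fun y => pair y (f y)) x ∈ HLe μ := by
  refine mem_HLe hμ (fun w hw => ?_) ((card_img_le _ _).trans hc)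
  obtain ⟨y, hy, rfl⟩ := mem_img.1 hw
  exact pair_mem_HLe hμ (mem_HLe_of_mem hx hy) (hf y hy)

end HLe

theorem pair_mem_img_pair {x a b : ZFSet.{0}} {f : ZFSet.{0} → ZFSet.{0}} :
    pair a b ∈ img (fun y => pair y (f y)) x ↔ a ∈ x ∧ f a = b := by
  rw [mem_img]
  constructor
  · rintro ⟨z, hz, h⟩
    obtain ⟨rfl, rfl⟩ := pair_injective h
    exact ⟨hz, rfl⟩
  · rintro ⟨ha, rfl⟩
    exact ⟨a, ha, rfl⟩

/-! ### From a club to a closing-off function -/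

/-- A sequence listing (at least) all elements of the countable set `S`. -/
def enum (S : ZFSet.{0}) : ℕ → ZFSet.{0} :=
  if h : ∃ f : ℕ → ZFSet.{0}, S.toSet ⊆ Set.range f then h.choose else fun _ => ∅

theorem exists_enum_eq {S x : ZFSet.{0}} (hS : Ctbl S) (hx : x ∈ S) : ∃ k, enum S k = x := by
  have h : ∃ f : ℕ → ZFSet.{0}, S.toSet ⊆ Set.range f :=
    Set.countable_iff_exists_subset_range.1 hS
  rw [enum, dif_pos h]
  exact h.choose_spec hx

theorem exists_function_of_club {γ : ZFSet.{0}} {S C : Set ZFSet.{0}} {P : ZFSet.{0} → Prop}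
    (hγ : IsOrd γ) (hinf : γ.toSet.Infinite) (hγS : γ.toSet ⊆ S) (hC : ClubSub S C)
    (hP : ∀ X ∈ C, P (collapse X γ)) :
    ∃ F : List ZFSet.{0} → ZFSet.{0},
      (∀ l : List ZFSet.{0}, (∀ z ∈ l, z ∈ γ) → F l ∈ γ) ∧
      ∀ X : ZFSet.{0}, X ⊆ γ → Ctbl X →
        (∀ l : List ZFSet.{0}, (∀ z ∈ l, z ∈ X) → F l ∈ X) → P (otype X) := by
  obtain ⟨hCS, hcof, hchain⟩ := hC
  obtain ⟨c, hc⟩ : ∃ c, c ∈ γ := hinf.nonempty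
  obtain ⟨X₀, hX₀⟩ : ∃ X, X ∈ C := by
    obtain ⟨B, hB⟩ := exists_toSet_eq_of_countable
      (Set.countable_range fun n => (hinf.natEmbedding γ.toSet n : ZFSet.{0}))
    obtain ⟨X, hX, -⟩ := hcof B
      (by rw [hB]; rintro _ ⟨n, rfl⟩; exact hγS (hinf.natEmbedding γ.toSet n).2)
      ⟨by rw [hB]; exact Set.countable_range _, by
        rw [hB]
        exact Set.infinite_range_of_injective
          (Subtype.val_injective.comp (hinf.natEmbedding γ.toSet).injective)⟩
    exact ⟨X, hX⟩
  have hext : ∀ X a, X ∈ C → a ∈ S → ∃ Y ∈ C, X ⊆ Y ∧ a ∈ Y := by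
    intro X a hX ha
    have hins : (insert a X : ZFSet.{0}).toSet = insert a X.toSet := by
      ext z
      exact mem_insert_iff
    obtain ⟨Y, hY, hsub⟩ := hcof (insert a X)
      (by rw [hins]; exact Set.insert_subset ha (hCS X hX).1)
      ⟨by rw [hins]; exact (hCS X hX).2.1.insert a,
        by rw [hins]; exact (hCS X hX).2.2.mono (Set.subset_insert _ _)⟩
    exact ⟨Y, hY, fun z hz => hsub (mem_insert_of_mem _ hz), hsub (mem_insert _ _)⟩
  choose! E hEC hE haE using hext
  let G : List ZFSet.{0} → ZFSet.{0} := fun l => l.foldr (fun a X => E X a) X₀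
  have hG : ∀ l : List ZFSet.{0}, (∀ z ∈ l, z ∈ γ) → G l ∈ C := by
    intro l hl
    induction l with
    | nil => exact hX₀
    | cons a l ih =>
      exact hEC _ _ (ih fun z hz => hl z (by simp [hz])) (hγS (hl a (by simp)))
  let F : List ZFSet.{0} → ZFSet.{0} := fun l =>
    let a := enum (G (l.drop (l.length - l.length.unpair.2)) ∩ γ) l.length.unpair.1
    if a ∈ γ then a else c
  refine ⟨F, fun l _ => ?_, fun Z hZγ hZc hZF => ?_⟩
  · by_cases h : enum (G (l.drop (l.length - l.length.unpair.2)) ∩ γ) l.length.unpair.1 ∈ γ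
    · simp [F, h]
    · simpa [F, h] using hc
  have hz₀ : F [] ∈ Z := hZF [] (by simp)
  have hGZ : ∀ l : List ZFSet.{0}, (∀ z ∈ l, z ∈ Z) → ∀ x ∈ G l ∩ γ, x ∈ Z := by
    intro l hl x hx
    have hctbl : Ctbl (G l ∩ γ) :=
      (hCS _ (hG l fun z hz => hZγ (hl z hz))).2.1.mono fun z hz => (mem_inter.1 hz).1
    obtain ⟨k, hk⟩ := exists_enum_eq hctbl hx
    have hle : l.length ≤ Nat.pair k l.length := Nat.right_le_pair _ _
    let l' := List.replicate (Nat.pair k l.length - l.length) (F []) ++ l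
    have hlen : l'.length = Nat.pair k l.length := by simp [l', hle]
    have hdrop : l'.drop (l'.length - l'.length.unpair.2) = l := by
      rw [hlen, Nat.unpair_pair]
      simp [l']
    have hFl : F l' = x := by
      have : enum (G (l'.drop (l'.length - l'.length.unpair.2)) ∩ γ) l'.length.unpair.1 = x := by
        rw [hdrop, hlen, Nat.unpair_pair]
        exact hk
      simp only [F, this, if_pos (mem_inter.1 hx).2]
    rw [← hFl]
    refine hZF l' fun z hz => ?_
    rcases List.mem_append.1 hz with hz | hz
    · rw [List.eq_of_mem_replicate hz]
      exact hz₀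
    · exact hl z hz
  obtain ⟨z, hz⟩ := hZc.exists_eq_range ⟨_, hz₀⟩
  have hzZ : ∀ n, z n ∈ Z := fun n => hz.ge ⟨n, rfl⟩
  let l : ℕ → List ZFSet.{0} := fun n => Nat.rec [] (fun n l => z n :: l) n
  have hl : ∀ n, ∀ y ∈ l n, y ∈ Z := by
    intro n
    induction n with
    | zero => simp [l]
    | succ n ih =>
      intro y hy
      rcases List.mem_cons.1 hy with rfl | hy
      · exact hzZ n
      · exact ih y hy
  have hlC : ∀ n, G (l n) ∈ C := fun n => hG _ fun y hy => hZγ (hl n y hy)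
  have hY := hchain (fun n => G (l n)) hlC fun n => hE _ _ (hlC n) (hγS (hZγ (hzZ n)))
  have hYZ : seqUnion (fun n => G (l n)) ∩ γ = Z := by
    ext x
    rw [mem_inter, mem_seqUnion]
    constructor
    · rintro ⟨⟨n, hn⟩, hx⟩
      exact hGZ (l n) (hl n) x (mem_inter.2 ⟨hn, hx⟩)
    · intro hx
      obtain ⟨n, rfl⟩ := hz.le hx
      exact ⟨⟨n + 1, haE _ _ (hlC n) (hγS (hZγ hx))⟩, hZγ hx⟩
  rw [← hYZ, otype_inter hγ]
  exact hP _ hY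

/-! ### Reflecting the closing-off function into elementary submodels -/

theorem IsSurjF.surjD {a b f : ZFSet.{0}} (h : IsSurjF a b f) : SurjD a b f := by
  obtain ⟨⟨hsub, hfun⟩, hsurj⟩ := h
  refine ⟨fun p hp => ?_, fun z hz => ?_, hsurj⟩
  · obtain ⟨x, hx, y, hy, rfl⟩ := mem_prod.1 (hsub hp)
    exact ⟨x, hx, y, hy, rfl⟩
  · obtain ⟨w, hw, huniq⟩ := hfun z hz
    exact ⟨w, (pair_mem_prod.1 (hsub hw)).2, hw, fun w' _ hw' => huniq w' hw'⟩

theorem SurjD.isSurjF {a b f : ZFSet.{0}} (h : SurjD a b f) : IsSurjF a b f := by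
  obtain ⟨hsub, hfun, hsurj⟩ := h
  have hsub' : f ⊆ prod a b := by
    intro p hp
    obtain ⟨x, hx, y, hy, rfl⟩ := hsub p hp
    exact pair_mem_prod.2 ⟨hx, hy⟩
  refine ⟨⟨hsub', fun z hz => ?_⟩, hsurj⟩
  obtain ⟨w, _, hw, huniq⟩ := hfun z hz
  exact ⟨w, hw, fun w' hw' => huniq w' (pair_mem_prod.1 (hsub' hw')).2 hw'⟩

theorem ordD_iff {α : ZFSet.{0}} : OrdD α ↔ IsOrd α :=
  ⟨fun h => ⟨fun x hx y hy => h.1 x hx y hy, fun x hx y hy z hz => h.2 x hx y hy z hz⟩,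
    fun h => ⟨fun x hx _ hy => h.1 x hx hy, fun x hx y hy _ hz => h.2 x hx y hy hz⟩⟩

theorem IsoD.otype_eq {Y α e : ZFSet.{0}} (hα : IsOrd α) (hY : ∀ y ∈ Y, IsOrd y)
    (h : IsoD Y α e) : otype Y = α := by
  obtain ⟨htot, hsurj, hiff⟩ := h
  have hYinj : ∀ y ∈ Y, ∀ y' ∈ Y, ∀ a ∈ α, pair y a ∈ e → pair y' a ∈ e → y = y' := by
    intro y hy y' hy' a ha h h'
    rcases (isOrd_iff.1 (hY y hy)).mem_trichotomous (isOrd_iff.1 (hY y' hy')) with hm | hm | hm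
    · exact (mem_irrefl _ ((hiff y hy a ha y' hy' a ha h h').1 hm)).elim
    · exact hm
    · exact (mem_irrefl _ ((hiff y' hy' a ha y hy a ha h' h).1 hm)).elim
  choose! g hgα hg using htot
  let f : Y.toSet → α.toSet := fun y => ⟨g y, hgα _ y.2⟩
  have hf : Function.Bijective f := by
    constructor
    · intro y y' h
      have h' : g y = g y' := congrArg Subtype.val h
      exact Subtype.ext (hYinj _ y.2 _ y'.2 _ (hgα _ y.2) (hg _ y.2) (h' ▸ hg _ y'.2))
    · rintro ⟨a, ha⟩
      obtain ⟨y, hy, hya⟩ := hsurj a ha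
      refine ⟨⟨y, hy⟩, Subtype.ext ?_⟩
      change g y = a
      have hgy := hg y hy
      rcases (isOrd_iff.1 (hα.mem (hgα y hy))).mem_trichotomous (isOrd_iff.1 (hα.mem ha))
        with hm | hm | hm
      · exact (mem_irrefl _ ((hiff y hy _ (hgα y hy) y hy a ha hgy hya).2 hm)).elim
      · exact hm
      · exact (mem_irrefl _ ((hiff y hy a ha y hy _ (hgα y hy) hya hgy).2 hm)).elim
  refine SRPPaper.otype_eq hα (Equiv.ofBijective f hf) fun a b => ?_
  exact hiff _ a.2 _ (hgα _ a.2) _ b.2 _ (hgα _ b.2) (hg _ a.2) (hg _ b.2)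

theorem not_badIn {M : Set ZFSet.{0}} {Y : ZFSet.{0}} (hY : ∀ y ∈ Y, IsOrd y)
    (h : LCard (otype Y)) : ¬ BadIn M Y := by
  rintro ⟨α, _, e, _, f, _, hα, he, ⟨β, hβ, hf⟩, hL⟩
  rw [he.otype_eq (ordD_iff.1 hα) hY] at h
  exact h.2 β hβ f hL.mem_LClass hf.isSurjF

theorem ctbl_of_ctblInM {M : Set ZFSet.{0}} {Y : ZFSet.{0}} (h : CtblInM M Y) : Ctbl Y := by
  obtain ⟨O, _, W, _, g, _, hO, hW, htot, hinj⟩ := h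
  have hOc : card O ≤ Cardinal.aleph0 :=
    ctbl_iff.1 (Set.Subsingleton.countable fun a ha b hb => hO a ha b hb)
  have hWc : card W ≤ Cardinal.aleph0 :=
    (card_mono fun w hw => mem_seqSet.2 (hW.exists_enc hw)).trans (card_seqSet_le le_rfl hOc)
  choose! n hnW hn using htot
  refine ctbl_iff.2 ((cardLE_iff.1 ⟨fun y => ⟨n y, hnW _ y.2⟩, fun y y' h => ?_⟩).trans hWc)
  have h' : n y = n y' := congrArg Subtype.val h
  exact Subtype.ext (hinj _ (hnW _ y.2) _ y.2 _ y'.2 (hn _ y.2) (h' ▸ hn _ y'.2))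

section
open Cardinal
variable {μ : Cardinal.{0}} {M : Set ZFSet.{0}}

theorem ctblInM_of_ctbl (hμ : ℵ₀ ≤ μ) (hM : HLe μ ⊆ M) {Y : ZFSet.{0}} (hY : Y ∈ HLe μ)
    (hYc : Ctbl Y) : CtblInM M Y := by
  have : Countable Y.toSet := hYc.to_subtype
  obtain ⟨c, hc⟩ := exists_injective_nat Y.toSet
  let c' : ZFSet.{0} → ZFSet.{0} := fun y =>
    if h : y ∈ Y then enc (List.replicate (c ⟨y, h⟩) ∅) else ∅
  have hc' : ∀ y ∈ Y, ∀ y' ∈ Y, c' y = c' y' → y = y' := by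
    intro y hy y' hy' h
    simp only [c', dif_pos hy, dif_pos hy'] at h
    have := congrArg List.length (enc_injective h)
    simp only [List.length_replicate] at this
    exact congrArg Subtype.val (hc this)
  have hcW : ∀ y ∈ Y, c' y ∈ seqSet {∅} := by
    intro y hy
    simp only [c', dif_pos hy]
    exact mem_seqSet.2 ⟨_, fun x hx => by simp [List.eq_of_mem_replicate hx], rfl⟩
  have h0 := empty_mem_HLe hμ
  have hO : ({∅} : ZFSet.{0}) ∈ HLe μ :=
    mem_HLe hμ (by simp [h0]) (by simpa using one_le_aleph0.trans hμ)
  have hW : seqSet {∅} ∈ HLe μ := seqSet_mem_HLe hμ hO (by simpa using one_le_aleph0.trans hμ)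
  have hmem : ∀ n y, pair n y ∈ img (fun y => pair (c' y) y) Y → y ∈ Y ∧ n = c' y := by
    intro n y h
    obtain ⟨y', hy', h⟩ := mem_img.1 h
    obtain ⟨rfl, rfl⟩ := pair_injective h
    exact ⟨hy', rfl⟩
  refine ⟨{∅}, hM hO, seqSet {∅}, hM hW, img (fun y => pair (c' y) y) Y, hM ?_,
    by simp, isLW_seqSet _, fun y hy => ⟨c' y, hcW y hy, mem_img.2 ⟨y, hy, rfl⟩⟩, ?_⟩
  · refine mem_HLe hμ (fun p hp => ?_) ((card_img_le _ _).trans ((ctbl_iff.1 hYc).trans hμ))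
    obtain ⟨y, hy, rfl⟩ := mem_img.1 hp
    exact pair_mem_HLe hμ (mem_HLe_of_mem hW (hcW y hy)) (mem_HLe_of_mem hY hy)
  · intro n _ y hy y' hy' h h'
    exact hc' y hy y' hy' ((hmem n y h).2.symm.trans (hmem n y' h').2)

theorem badIn_of_not_lCard (hμ : ℵ₀ ≤ μ) (hM : HLe μ ⊆ M) {X γ : ZFSet.{0}} (hγ : IsOrd γ)
    (hγμ : γ ∈ HLe μ) (hX : Ctbl X) (h : ¬ LCard (collapse X γ)) : BadIn M (X ∩ γ) := by
  set α := collapse X γ with hα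
  have hαo : IsOrd α := isOrd_collapse hγ
  have hαimg : α.toSet = collapse X '' (X ∩ γ).toSet := by
    ext w
    refine mem_collapse.trans ⟨?_, ?_⟩
    · rintro ⟨z, hz, hzX, rfl⟩
      exact ⟨z, mem_inter.2 ⟨hzX, hz⟩, rfl⟩
    · rintro ⟨z, hz, rfl⟩
      exact ⟨z, (mem_inter.1 hz).2, (mem_inter.1 hz).1, rfl⟩
  have hYc : Ctbl (X ∩ γ) := hX.mono fun z hz => (mem_inter.1 hz).1
  have hαc : Ctbl α := by
    rw [Ctbl, hαimg]
    exact hYc.image _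
  have hle : ∀ {x}, Ctbl x → card x ≤ μ := fun hx => (ctbl_iff.1 hx).trans hμ
  have hαH : α ∈ HLe μ := mem_HLe_of_isTransitive hμ hαo.1 (hle hαc)
  have hYH : X ∩ γ ∈ HLe μ :=
    mem_HLe_of_ctbl hμ (fun y hy => mem_HLe_of_mem hγμ (mem_inter.1 hy).2) hYc
  obtain ⟨β, hβ, f, hfL, hf⟩ : ∃ β ∈ α, ∃ f ∈ LClass, IsSurjF β α f := by
    by_contra hcon
    exact h ⟨hαo, fun β hβ f hf hs => hcon ⟨β, hβ, f, hf, hs⟩⟩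
  have hβc : Ctbl β := hαc.mono fun z hz => hαo.1 _ hβ hz
  have hfc : Ctbl f := by
    have hprod : (prod β α).toSet ⊆ (fun p => pair p.1 p.2) '' β.toSet ×ˢ α.toSet := by
      intro p hp
      obtain ⟨a, ha, b, hb, rfl⟩ := mem_prod.1 hp
      exact ⟨(a, b), ⟨ha, hb⟩, rfl⟩
    exact (((hβc.prod hαc).image _).mono hprod).mono fun p hp => hf.1.1 hp
  have hfH : f ∈ HLe ℵ₀ := by
    have hαH' : α ∈ HLe ℵ₀ := mem_HLe_of_isTransitive le_rfl hαo.1 (ctbl_iff.1 hαc)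
    refine mem_HLe_of_ctbl le_rfl (fun p hp => ?_) hfc
    obtain ⟨a, ha, b, hb, rfl⟩ := mem_prod.1 (hf.1.1 hp)
    exact pair_mem_HLe le_rfl (mem_HLe_of_mem hαH' (hαo.1 _ hβ ha)) (mem_HLe_of_mem hαH' hb)
  obtain ⟨t, ht, hft, htc⟩ := hfH
  obtain ⟨N, hN, hNc, hNL⟩ := exists_countable_inLIn hfL ht (ctbl_iff.2 htc) hft
  refine ⟨α, hM hαH, img (fun y => pair y (collapse X y)) (X ∩ γ),
    hM (img_pair_mem_HLe hμ hYH (hle hYc) fun y hy => ?_), f,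
    hM ⟨t, ht, hft, htc.trans hμ⟩, ordD_iff.2 hαo, ⟨?_, ?_, ?_⟩, ⟨β, hβ, hf.surjD⟩,
    hNL.mono fun x hx => hM ⟨N, hN, hx, hle hNc⟩⟩
  · exact mem_HLe_of_mem hαH (hαimg.ge ⟨y, hy, rfl⟩)
  · exact fun y hy => ⟨_, hαimg.ge ⟨y, hy, rfl⟩, pair_mem_img_pair.2 ⟨hy, rfl⟩⟩
  · intro a ha
    obtain ⟨y, hy, rfl⟩ := hαimg.le ha
    exact ⟨y, hy, pair_mem_img_pair.2 ⟨hy, rfl⟩⟩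
  · intro y hy a _ y' hy' a' _ h h'
    obtain ⟨-, rfl⟩ := pair_mem_img_pair.1 h
    obtain ⟨-, rfl⟩ := pair_mem_img_pair.1 h'
    obtain ⟨hyX, hyγ⟩ := mem_inter.1 hy
    obtain ⟨hyX', hyγ'⟩ := mem_inter.1 hy'
    exact (collapse_mem_iff (hγ.mem hyγ) (hγ.mem hyγ') hyX hyX').symm

end

theorem ElemSub.exists_satM {M : TClass} {X : ZFSet.{0}} (hX : ElemSub X M.1) {n : ℕ}
    (φ : Fml (n + 1)) (v : Fin n → M.1) (hv : ∀ i, (v i).1 ∈ X)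
    (h : ∃ x : M.1, SatM M φ (Fin.cons x v)) :
    ∃ x : M.1, x.1 ∈ X ∧ SatM M φ (Fin.cons x v) := by
  obtain ⟨⟨x, hx⟩, hs⟩ := h
  rw [SatM, cons_val] at hs
  obtain ⟨y, hy, hs⟩ := hX.exists_witness φ (fun i => (v i).1) hv ⟨x, hx, hs⟩
  refine ⟨⟨y, hX.1 hy⟩, hy, ?_⟩
  rwa [SatM, cons_val]

theorem lCard_collapse_of_function {γ κ X : ZFSet.{0}} (hγ : IsOrd γ) (hinf : γ.toSet.Infinite)
    (hγκ : γ ∈ κ) {F : List ZFSet.{0} → ZFSet.{0}}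
    (hFγ : ∀ l : List ZFSet.{0}, (∀ z ∈ l, z ∈ γ) → F l ∈ γ)
    (hF : ∀ X : ZFSet.{0}, X ⊆ γ → Ctbl X →
      (∀ l : List ZFSet.{0}, (∀ z ∈ l, z ∈ X) → F l ∈ X) → LCard (otype X))
    (hX : ElemSub X (Hset κ)) (hXc : Ctbl X) (hγX : γ ∈ X) : LCard (collapse X γ) := by
  have hμ : Cardinal.aleph0 ≤ card γ := by
    rw [← Cardinal.aleph0_le_lift.{0, 1}, ← mk_toSet]
    exact Cardinal.infinite_iff.1 hinf.to_subtype
  have hM := HLe_subset_Hset hγκ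
  have hγH : γ ∈ HLe (card γ) := mem_HLe_of_isTransitive hμ hγ.1 le_rfl
  have hWH := seqSet_mem_HLe hμ hγH le_rfl
  let M : TClass := ⟨Hset κ, fun _ hx _ hy => mem_of_mem_Hset hx hy⟩
  let F' := img (fun w => pair w (F (Function.invFun enc w))) (seqSet γ)
  have hF' : ∀ l : List ZFSet.{0}, ∀ a, pair (enc l) a ∈ F' → F l = a := by
    intro l a h
    have := (pair_mem_img_pair.1 h).2
    rwa [Function.leftInverse_invFun enc_injective] at this
  have hF'H : F' ∈ Hset κ := by
    refine hM (img_pair_mem_HLe hμ hWH (card_seqSet_le hμ le_rfl) fun w hw => ?_)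
    obtain ⟨l, hl, rfl⟩ := mem_seqSet.1 hw
    rw [Function.leftInverse_invFun enc_injective]
    exact mem_HLe_of_mem hγH (hFγ l hl)
  have hθ : ThetaIn (Hset κ) γ F' := by
    refine ⟨⟨seqSet γ, hM hWH, isLW_seqSet γ, fun u hu => ?_⟩,
      fun Y _ hYγ W _ hW hYc hcl => not_badIn (fun y hy => hγ.mem (hYγ hy))
        (hF Y hYγ (ctbl_of_ctblInM hYc) fun l hl => ?_)⟩
    · obtain ⟨l, hl, rfl⟩ := mem_seqSet.1 hu
      refine ⟨F l, hFγ l hl, pair_mem_img_pair.2 ⟨hu, ?_⟩⟩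
      rw [Function.leftInverse_invFun enc_injective]
    · obtain ⟨a, ha, hla⟩ := hcl _ (hW.enc_mem hl)
      rwa [hF' l a hla]
  obtain ⟨⟨G, hGH⟩, hGX, hG⟩ := hX.exists_satM (M := M) (.theta 1 0) ![⟨γ, hX.1 hγX⟩]
    (by simpa using hγX) ⟨⟨F', hF'H⟩, (satM_theta _ _ _).2 hθ⟩
  obtain ⟨⟨W, hWM, hW, hWG⟩, hG⟩ := (satM_theta _ _ _).1 hG
  by_contra hL
  have hYγ : X ∩ γ ⊆ γ := fun z hz => (mem_inter.1 hz).2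
  have hYc : Ctbl (X ∩ γ) := hXc.mono fun z hz => (mem_inter.1 hz).1
  have hYH : X ∩ γ ∈ HLe (card γ) :=
    mem_HLe_of_ctbl hμ (fun y hy => mem_HLe_of_mem hγH (hYγ hy)) hYc
  refine hG (X ∩ γ) (hM hYH) hYγ (seqSet (X ∩ γ))
    (hM (seqSet_mem_HLe hμ hYH (card_mono hYγ))) (isLW_seqSet _)
    (ctblInM_of_ctbl hμ hM hYH hYc) (fun u hu => ?_)
    (badIn_of_not_lCard hμ hM hγ hγH hXc hL)
  obtain ⟨l, hl, rfl⟩ := mem_seqSet.1 hu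
  have hlX : enc l ∈ X ∧ enc l ∈ HLe (card γ) := by
    clear hu
    induction l with
    | nil =>
      obtain ⟨⟨y, _⟩, hy, hs⟩ := hX.exists_satM (M := M) (.isEmpty 0) ![] (by simp)
        ⟨⟨∅, hM (empty_mem_HLe hμ)⟩, (satM_isEmpty _ _).2 rfl⟩
      have : y = ∅ := (satM_isEmpty _ _).1 hs
      subst this
      exact ⟨hy, empty_mem_HLe hμ⟩
    | cons x l ih =>
      obtain ⟨hlX, hlH⟩ := ih fun y hy => hl y (by simp [hy])
      obtain ⟨hxX, hxγ⟩ := mem_inter.1 (hl x (by simp))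
      have hp := pair_mem_HLe hμ (mem_HLe_of_mem hγH hxγ) hlH
      obtain ⟨⟨y, _⟩, hy, hs⟩ := hX.exists_satM (M := M) (.isPair 0 1 2)
        ![⟨x, hX.1 hxX⟩, ⟨enc l, hX.1 hlX⟩] (by simp [Fin.forall_fin_two, hxX, hlX])
        ⟨⟨_, hM hp⟩, (satM_isPair _ _ _ _).2 rfl⟩
      have : y = pair x (enc l) := (satM_isPair _ _ _ _).1 hs
      subst this
      exact ⟨hy, hp⟩
  obtain ⟨a, ha, hla⟩ := hWG _ (hW.enc_mem fun x hx => hYγ (hl x hx))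
  obtain ⟨⟨b, _⟩, hb, hs⟩ := hX.exists_satM (M := M) (.and (.mem 0 1) (.pairIn 2 0 3))
    ![⟨γ, hX.1 hγX⟩, ⟨enc l, hX.1 hlX.1⟩, ⟨G, hGH⟩]
    (by simp [Fin.forall_fin_succ, hγX, hlX.1, hGX])
    ⟨⟨a, mem_of_mem_Hset (hX.1 hγX) ha⟩,
      (satM_and _ _ _).2 ⟨(satM_mem _ _ _).2 ha, (satM_pairIn _ _ _ _).2 hla⟩⟩
  obtain ⟨hbγ, hlb⟩ := (satM_and _ _ _).1 hs
  exact ⟨b, mem_inter.2 ⟨hb, hbγ⟩, (satM_pairIn _ _ _ _).1 hlb⟩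

/-! ## The statement -/

/-- Proposition 2.4: equivalent characterizations of `SRP^L(γ)` for an
`L`-cardinal `γ ≥ ω₁`. -/
theorem statement0 (γ : ZFSet.{0}) (hγ : Aleph 1 ∈ γ ∨ Aleph 1 = γ) (hL : LCard γ) :
    List.TFAE
      [SRPL γ,
       ∀ κ, IsRegular κ → γ ∈ κ →
         ∀ X : ZFSet.{0}, ElemSub X (Hset κ) → CtblInf X → γ ∈ X → LCard (collapse X γ),
       ∃ κ, IsRegular κ ∧ γ ∈ κ ∧ ∃ C : Set ZFSet.{0}, ClubSub (Hset κ) C ∧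
         C ⊆ {X | ElemSub X (Hset κ) ∧ CtblInf X ∧ γ ∈ X ∧ LCard (collapse X γ)},
       ∃ F : List ZFSet.{0} → ZFSet.{0},
         (∀ l : List ZFSet.{0}, (∀ z ∈ l, z ∈ γ) → F l ∈ γ) ∧
         ∀ X : ZFSet.{0}, X ⊆ γ → Ctbl X →
           (∀ l : List ZFSet.{0}, (∀ z ∈ l, z ∈ X) → F l ∈ X) → LCard (otype X),
       ∀ κ, IsRegular κ → γ ∈ κ → ∃ C : Set ZFSet.{0}, ClubSub (Hset κ) C ∧
         C ⊆ {X | ElemSub X (Hset κ) ∧ CtblInf X ∧ γ ∈ X ∧ LCard (collapse X γ)}] := by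
  have hord : IsOrd γ := hL.1
  have hinf : γ.toSet.Infinite := infinite_of_aleph_one hord hγ
  have hγH : ∀ {κ}, γ ∈ κ → γ ∈ Hset κ := fun hκ =>
    HLe_subset_Hset hκ (mem_HLe_of_isTransitive (by
      rw [← Cardinal.aleph0_le_lift.{0, 1}, ← mk_toSet]
      exact Cardinal.infinite_iff.1 hinf.to_subtype) hord.1 le_rfl)
  have hclub : ∀ κ, γ ∈ κ →
      (∀ X : ZFSet.{0}, ElemSub X (Hset κ) → CtblInf X → γ ∈ X → LCard (collapse X γ)) →
      ∃ C : Set ZFSet.{0}, ClubSub (Hset κ) C ∧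
        C ⊆ {X | ElemSub X (Hset κ) ∧ CtblInf X ∧ γ ∈ X ∧ LCard (collapse X γ)} :=
    fun κ hκ h => ⟨_, clubSub_elemSub (hγH hκ),
      fun X hX => ⟨hX.1, hX.2.1, hX.2.2, h X hX.1 hX.2.1 hX.2.2⟩⟩
  tfae_have 1 → 3 := fun ⟨κ, hκ, hγκ, h⟩ => ⟨κ, hκ, hγκ, hclub κ hγκ h⟩
  tfae_have 3 → 4 := fun ⟨κ, _, hγκ, C, hC, hsub⟩ =>
    exists_function_of_club hord hinf (fun _ hx => mem_of_mem_Hset (hγH hγκ) hx) hC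
      fun X hX => (hsub hX).2.2.2
  tfae_have 4 → 2 := fun ⟨F, hFγ, hF⟩ κ _ hγκ X hX hXc hγX =>
    lCard_collapse_of_function hord hinf hγκ hFγ hF hX hXc.1 hγX
  tfae_have 2 → 1 := fun h =>
    let ⟨κ, hκ, hγκ⟩ := exists_isRegular hord
    ⟨κ, hκ, hγκ, h κ hκ hγκ⟩
  tfae_have 2 → 5 := fun h κ hκ hγκ => hclub κ hγκ (h κ hκ hγκ)
  tfae_have 5 → 3 := fun h =>
    let ⟨κ, hκ, hγκ⟩ := exists_isRegular hord
    ⟨κ, hκ, hγκ, h κ hκ hγκ⟩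
  tfae_finish

end SRPPaper
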